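/- Let d ≥ 1, let 1 ≤ p₀, p₁, p₂, q₁, q₂, q₃ ≤ ∞ satisfy 1/p₀ ≤ 1/p₁ + 1/p₂ and 1 + 1/q₃ ≤ 1/q₁ + 1/q₂. Then there is a constant C > 0 (depending only on d and the exponents and the windows) such that for every bounded measurable symbol σ : ℝ^{3d} → ℂ with ‖σ‖_{𝓜^{(∞,1,1);(∞,∞,1)}} := ∫_{ℝ^d} ess sup_{ξ₁,ξ₂} ∫_{ℝ^{d}} ∫_{ℝ^{d}} ess sup_{x} |𝒱_Φσ(x,t₁,t₂,ξ₁,ξ₂,ν)| dt₁ dt₂ dν < ∞, and for all Schwartz functions f₁, f₂ on ℝ^d, the bilinear pseudodifferential operator satisfies ‖T_σ(f₁,f₂)‖_{M^{p₀,q₃}} ≤ C · ‖σ‖_{𝓜^{(∞,1,1);(∞,∞,1)}} · ‖f₁‖_{M^{p₁,q₁}} · ‖f₂‖_{M^{p₂,q₂}}. -/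

import Mathlib

open MeasureTheory Complex
open scoped ENNReal NNReal RealInnerProductSpace

noncomputable section

abbrev Ed (d : ℕ) := EuclideanSpace ℝ (Fin d)

/-- `e2pi a = e^{2πi a}`. -/
def e2pi (a : ℝ) : ℂ := Complex.exp (2 * Real.pi * Complex.I * (a : ℂ))

/-- Short-time Fourier transform `V_φ f (t, ν)`. -/
def STFT (d : ℕ) (φ f : Ed d → ℂ) (t ν : Ed d) : ℂ :=
  ∫ y, f y * e2pi (-⟪y, ν⟫) * φ (y - t)

/-- The Gaussian window `e^{-‖x‖²}` as a complex-valued function. -/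
def gauss (d : ℕ) : Ed d → ℂ := fun x => (Real.exp (-‖x‖ ^ 2) : ℝ)

/-- `L^p`-type norm (`ℝ≥0∞`-valued) with essential supremum in case `p = ∞`. -/
def eNorm {α : Type*} [MeasurableSpace α] (μ : Measure α) (p : ℝ≥0∞) (F : α → ℝ≥0∞) : ℝ≥0∞ :=
  if p = ∞ then essSup F μ else (∫⁻ a, F a ^ p.toReal ∂μ) ^ (1 / p.toReal)

/-- Modulation space norm `‖f‖_{M^{p,q}}` with the Gaussian window. -/
def modNorm (d : ℕ) (p q : ℝ≥0∞) (f : Ed d → ℂ) : ℝ≥0∞ :=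
  eNorm volume q fun ν => eNorm volume p fun t => (‖STFT d (gauss d) f t ν‖₊ : ℝ≥0∞)

/-- The Gaussian window on `ℝ^{3d}`. -/
def gauss3 (d : ℕ) : Ed d × Ed d × Ed d → ℂ :=
  fun X => (Real.exp (-‖X.1‖ ^ 2 - ‖X.2.1‖ ^ 2 - ‖X.2.2‖ ^ 2) : ℝ)

/-- Symbol short-time Fourier transform of a symbol on `ℝ^{3d}`. -/
def symbSTFT (d : ℕ) (Φ σ : Ed d × Ed d × Ed d → ℂ) (x t₁ t₂ ξ₁ ξ₂ ν : Ed d) : ℂ :=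
  ∫ X : Ed d × Ed d × Ed d,
    σ X * Φ (X.1 - x, X.2.1 - ξ₁, X.2.2 - ξ₂) *
      e2pi (-(⟪X.1, ν⟫ - ⟪t₁, X.2.1⟫ - ⟪t₂, X.2.2⟫))

/-- Fourier transform. -/
def FT (d : ℕ) (f : Ed d → ℂ) (ξ : Ed d) : ℂ := ∫ y, f y * e2pi (-⟪y, ξ⟫)

/-- Bilinear pseudodifferential operator `T_σ`. -/
def biOp (d : ℕ) (σ : Ed d × Ed d × Ed d → ℂ) (f₁ f₂ : Ed d → ℂ) (x : Ed d) : ℂ :=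
  ∫ ξ : Ed d × Ed d,
    e2pi ⟪x, ξ.1 + ξ.2⟫ * σ (x, ξ.1, ξ.2) * FT d f₁ ξ.1 * FT d f₂ ξ.2


/-- The symbol norm `‖σ‖_{𝓜^{(∞,1,1);(∞,∞,1)}}`:
`∫ ess sup_{ξ₁,ξ₂} ∫∫ ess sup_x |𝒱_Φ σ (x,t₁,t₂,ξ₁,ξ₂,ν)| dt₁ dt₂ dν`. -/
def normInf11 (d : ℕ) (σ : Ed d × Ed d × Ed d → ℂ) : ℝ≥0∞ :=
  ∫⁻ ν, essSup (fun ξ : Ed d × Ed d =>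
    ∫⁻ t₂, ∫⁻ t₁,
      essSup (fun x => (‖symbSTFT d (gauss3 d) σ x t₁ t₂ ξ.1 ξ.2 ν‖₊ : ℝ≥0∞)) volume) volume

theorem measurable_essSup {α β : Type*} [MeasurableSpace α] [MeasurableSpace β] {ν : Measure β}
    [SFinite ν] {F : α → β → ℝ≥0∞} (hF : Measurable (Function.uncurry F)) :
    Measurable fun a => essSup (F a) ν := by
  refine measurable_of_Iic fun c => ?_
  have h : (fun a => essSup (F a) ν) ⁻¹' Set.Iic c
      = (fun a => ν (Prod.mk a ⁻¹' {z | c < Function.uncurry F z})) ⁻¹' {0} := by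
    ext a
    simp only [Set.mem_preimage, Set.mem_Iic, Set.mem_singleton_iff]
    constructor
    · intro h
      refine measure_mono_null (fun b hb => ?_) (meas_essSup_lt (f := F a) (μ := ν))
      exact lt_of_le_of_lt h hb
    · intro h
      refine essSup_le_of_ae_le c ?_
      rw [Filter.EventuallyLE, ae_iff]
      simpa [Set.preimage, Function.uncurry] using h
  rw [h]
  exact measurable_measure_prodMk_left (measurableSet_lt measurable_const hF)
    (measurableSet_singleton 0)

theorem measurable_eNorm {α β : Type*} [MeasurableSpace α] [MeasurableSpace β] {ν : Measure β}
    [SFinite ν] {F : α → β → ℝ≥0∞} (p : ℝ≥0∞) (hF : Measurable (Function.uncurry F)) :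
    Measurable fun a => eNorm ν p (F a) := by
  unfold eNorm
  split_ifs
  · exact measurable_essSup hF
  · exact (Measurable.lintegral_prod_right (hF.pow_const _)).pow_const _

theorem eNorm_mono_ae {α : Type*} [MeasurableSpace α] {μ : Measure α} (p : ℝ≥0∞)
    {F G : α → ℝ≥0∞} (h : ∀ᵐ a ∂μ, F a ≤ G a) : eNorm μ p F ≤ eNorm μ p G := by
  unfold eNorm
  split_ifs
  · exact essSup_mono_ae h
  · refine ENNReal.rpow_le_rpow (lintegral_mono_ae ?_) (by positivity)
    filter_upwards [h] with a ha
    exact ENNReal.rpow_le_rpow ha (by positivity)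

theorem eNorm_const_mul_le {α : Type*} [MeasurableSpace α] {μ : Measure α} {p : ℝ≥0∞}
    (hp : 1 ≤ p) (c : ℝ≥0∞) {F : α → ℝ≥0∞} (hF : Measurable F) :
    eNorm μ p (fun a => c * F a) ≤ c * eNorm μ p F := by
  unfold eNorm
  split_ifs with h
  · exact (ENNReal.essSup_const_mul).le
  · have hp0 : 0 < p.toReal := ENNReal.toReal_pos (by positivity) h
    simp_rw [ENNReal.mul_rpow_of_nonneg _ _ hp0.le]
    rw [lintegral_const_mul _ (hF.pow_const _), ENNReal.mul_rpow_of_nonneg _ _ (by positivity),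
      ← ENNReal.rpow_mul, mul_one_div_cancel hp0.ne', ENNReal.rpow_one]

theorem eNorm_one {α : Type*} [MeasurableSpace α] {μ : Measure α} (F : α → ℝ≥0∞) :
    eNorm μ 1 F = ∫⁻ a, F a ∂μ := by
  simp [eNorm]

/-- **Minkowski's integral inequality**. -/
theorem eNorm_lintegral_le {α β : Type*} [MeasurableSpace α] [MeasurableSpace β]
    {μ : Measure α} {ν : Measure β} [SFinite μ] [SFinite ν] {p : ℝ≥0∞} (hp : 1 ≤ p)
    {F : α → β → ℝ≥0∞} (hF : Measurable (Function.uncurry F)) :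
    eNorm μ p (fun x => ∫⁻ y, F x y ∂ν) ≤ ∫⁻ y, eNorm μ p (fun x => F x y) ∂ν := by
  have hF' : Measurable (Function.uncurry fun y x => F x y) := hF.comp measurable_swap
  by_cases htop : p = ∞
  · simp only [eNorm, htop, if_true]
    refine essSup_le_of_ae_le _ ?_
    have h1 : ∀ᵐ z ∂(ν.prod μ), F z.2 z.1 ≤ essSup (fun x => F x z.1) μ := by
      refine (Measure.ae_prod_iff_ae_ae ?_).2 (Filter.Eventually.of_forall fun y => ?_)
      · exact measurableSet_le hF' ((measurable_essSup hF').comp measurable_fst)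
      · exact ENNReal.ae_le_essSup (fun x => F x y)
    have h2 := (Measure.measurePreserving_swap (μ := μ) (ν := ν)).quasiMeasurePreserving.ae h1
    filter_upwards [Measure.ae_ae_of_ae_prod h2] with x hx
    exact lintegral_mono_ae hx
  set r := p.toReal with hr
  have hr1 : 1 ≤ r := by
    rw [hr, ← ENNReal.toReal_one]; exact ENNReal.toReal_mono htop hp
  have hr0 : 0 < r := by linarith
  set N : β → ℝ≥0∞ := fun y => eNorm μ p (fun x => F x y) with hN
  have hNm : Measurable N := measurable_eNorm p hF'
  have hNr : ∀ y, N y ^ r = ∫⁻ x, F x y ^ r ∂μ := fun y => by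
    simp only [hN, eNorm, htop, if_false]
    rw [← ENNReal.rpow_mul, one_div_mul_cancel hr0.ne', ENNReal.rpow_one]
  by_cases hfin : ∫⁻ y, N y ∂ν = ∞
  · rw [hfin]; exact le_top
  have hNfin : ∀ᵐ y ∂ν, N y < ∞ := ae_lt_top hNm hfin
  have hzero : ∀ᵐ x ∂μ, ∀ᵐ y ∂ν, N y = 0 → F x y = 0 := by
    have h1 : ∀ᵐ z ∂(ν.prod μ), N z.1 = 0 → F z.2 z.1 = 0 := by
      refine (Measure.ae_prod_iff_ae_ae ?_).2 (Filter.Eventually.of_forall fun y => ?_)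
      · have : {z : β × α | N z.1 = 0 → F z.2 z.1 = 0}
            = {z | N z.1 = 0}ᶜ ∪ {z | F z.2 z.1 = 0} := by
          ext z; simp only [Set.mem_ofPred_eq, Set.mem_union, Set.mem_compl_iff]; tauto
        rw [this]
        exact ((hNm.comp measurable_fst) (measurableSet_singleton 0)).compl.union
          (hF' (measurableSet_singleton 0))
      · by_cases hy : N y = 0
        · have h0 : ∫⁻ x, F x y ^ r ∂μ = 0 := by rw [← hNr, hy, ENNReal.zero_rpow_of_pos hr0]
          rw [lintegral_eq_zero_iff ((hF'.of_uncurry_left).pow_const _)] at h0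
          filter_upwards [h0] with x hx _
          simpa [hr0, hr0.not_gt] using hx
        · exact Filter.Eventually.of_forall fun x h => absurd h hy
    have h2 := (Measure.measurePreserving_swap (μ := μ) (ν := ν)).quasiMeasurePreserving.ae h1
    exact Measure.ae_ae_of_ae_prod h2
  have hw1 : 0 ≤ 1 / r := by positivity
  have hw2 : 0 ≤ 1 - 1 / r := by
    rw [sub_nonneg, div_le_one hr0]; exact hr1
  have key : ∀ᵐ x ∂μ, (∫⁻ y, F x y ∂ν) ^ r
      ≤ (∫⁻ y, F x y ^ r * N y ^ (1 - r) ∂ν) * (∫⁻ y, N y ∂ν) ^ (r - 1) := by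
    filter_upwards [hzero] with x hx
    have h1 : ∫⁻ y, F x y ∂ν
        ≤ ∫⁻ y, (F x y ^ r * N y ^ (1 - r)) ^ (1 / r) * N y ^ (1 - 1 / r) ∂ν := by
      refine lintegral_mono_ae ?_
      filter_upwards [hx, hNfin] with y hy hyt
      by_cases h0 : N y = 0
      · simp [hy h0]
      · rw [ENNReal.mul_rpow_of_nonneg _ _ hw1, ← ENNReal.rpow_mul, ← ENNReal.rpow_mul,
          mul_one_div_cancel hr0.ne', ENNReal.rpow_one, mul_assoc, ← ENNReal.rpow_add _ _ h0 hyt.ne]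
        have : (1 - r) * (1 / r) + (1 - 1 / r) = 0 := by field_simp; ring
        rw [this, ENNReal.rpow_zero, mul_one]
    have h2 := ENNReal.lintegral_mul_norm_pow_le (μ := ν)
      (f := fun y => F x y ^ r * N y ^ (1 - r)) (g := N)
      (((hF.of_uncurry_left).pow_const _).mul (hNm.pow_const _)).aemeasurable hNm.aemeasurable
      hw1 hw2 (by ring)
    refine (ENNReal.rpow_le_rpow (h1.trans h2) hr0.le).trans_eq ?_
    rw [ENNReal.mul_rpow_of_nonneg _ _ hr0.le, ← ENNReal.rpow_mul, ← ENNReal.rpow_mul,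
      one_div_mul_cancel hr0.ne', ENNReal.rpow_one]
    congr 2
    field_simp
  have hmeas : Measurable (Function.uncurry fun x y => F x y ^ r * N y ^ (1 - r)) :=
    (hF.pow_const _).mul ((hNm.comp measurable_snd).pow_const _)
  have main : ∫⁻ x, (∫⁻ y, F x y ∂ν) ^ r ∂μ ≤ (∫⁻ y, N y ∂ν) ^ r := by
    refine (lintegral_mono_ae key).trans ?_
    rw [lintegral_mul_const _ hmeas.lintegral_prod_right,
      lintegral_lintegral_swap hmeas.aemeasurable]
    have h3 : ∫⁻ y, ∫⁻ x, F x y ^ r * N y ^ (1 - r) ∂μ ∂ν ≤ ∫⁻ y, N y ∂ν := by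
      refine lintegral_mono_ae ?_
      filter_upwards [hNfin] with y hyt
      rw [lintegral_mul_const _ ((hF'.of_uncurry_left).pow_const _), ← hNr]
      by_cases h0 : N y = 0
      · simp [h0, hr0]
      · rw [← ENNReal.rpow_add _ _ h0 hyt.ne]; simp
    refine (mul_le_mul_left h3 _).trans ?_
    by_cases h0 : ∫⁻ y, N y ∂ν = 0
    · simp [h0]
    · conv_lhs => rw [← ENNReal.rpow_one (∫⁻ y, N y ∂ν), ← ENNReal.rpow_mul, one_mul]
      rw [← ENNReal.rpow_add _ _ h0 hfin]; simp
  calc eNorm μ p (fun x => ∫⁻ y, F x y ∂ν) = (∫⁻ x, (∫⁻ y, F x y ∂ν) ^ r ∂μ) ^ (1 / r) := by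
        simp [eNorm, htop, hr]
    _ ≤ ((∫⁻ y, N y ∂ν) ^ r) ^ (1 / r) := ENNReal.rpow_le_rpow main hw1
    _ = ∫⁻ y, N y ∂ν := by
        rw [← ENNReal.rpow_mul, mul_one_div_cancel hr0.ne', ENNReal.rpow_one]

theorem eNorm_comp_measurePreserving {α β : Type*} [MeasurableSpace α] [MeasurableSpace β]
    {μ : Measure α} {ν : Measure β} {g : α → β} (hg : MeasurePreserving g μ ν) (p : ℝ≥0∞)
    {F : β → ℝ≥0∞} (hF : Measurable F) : eNorm μ p (fun a => F (g a)) = eNorm ν p F := by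
  unfold eNorm
  split_ifs
  · rw [← hg.map_eq, essSup_map_measure_of_measurable hF hg.measurable.aemeasurable]
    rfl
  · rw [hg.lintegral_comp (hF.pow_const p.toReal)]

/-- **Hölder's inequality** for products. -/
theorem eNorm_mul_le {α : Type*} [MeasurableSpace α] {μ : Measure α} {p₀ p₁ p₂ : ℝ≥0∞}
    (hp₀ : 1 ≤ p₀) (h : p₀⁻¹ = p₁⁻¹ + p₂⁻¹) {F G : α → ℝ≥0∞} (hF : Measurable F)
    (hG : Measurable G) :
    eNorm μ p₀ (fun a => F a * G a) ≤ eNorm μ p₁ F * eNorm μ p₂ G := by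
  by_cases h1 : p₁ = ∞
  · have h02 : p₀ = p₂ := by simpa [h1] using h
    subst h1 h02
    refine (eNorm_mono_ae (G := fun a => essSup F μ * G a) _ ?_).trans
      ((eNorm_const_mul_le hp₀ _ hG).trans_eq (by simp [eNorm]))
    filter_upwards [ENNReal.ae_le_essSup F] with a ha
    gcongr
  by_cases h2 : p₂ = ∞
  · have h01 : p₀ = p₁ := by simpa [h2] using h
    subst h2 h01
    refine (eNorm_mono_ae (G := fun a => essSup G μ * F a) _ ?_).trans
      ((eNorm_const_mul_le hp₀ _ hF).trans_eq (by simp [eNorm, mul_comm]))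
    filter_upwards [ENNReal.ae_le_essSup G] with a ha
    rw [mul_comm]
    gcongr
  have h0 : p₀ ≠ ∞ := by
    rintro rfl
    rw [ENNReal.inv_top, eq_comm, add_eq_zero] at h
    exact h1 (ENNReal.inv_eq_zero.1 h.1)
  have hle1 : p₀ ≤ p₁ := ENNReal.inv_le_inv.1 (h ▸ le_self_add)
  have hle2 : p₀ ≤ p₂ := ENNReal.inv_le_inv.1 (h ▸ le_add_self)
  have r0 : 0 < p₀.toReal := ENNReal.toReal_pos (by positivity) h0
  have r1 : 0 < p₁.toReal := r0.trans_le (ENNReal.toReal_mono h1 hle1)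
  have r2 : 0 < p₂.toReal := r0.trans_le (ENNReal.toReal_mono h2 hle2)
  have hr : (p₀.toReal)⁻¹ = (p₁.toReal)⁻¹ + (p₂.toReal)⁻¹ := by
    rw [← ENNReal.toReal_inv, ← ENNReal.toReal_inv, ← ENNReal.toReal_inv, h,
      ENNReal.toReal_add]
    · exact ENNReal.inv_ne_top.2 (by rintro rfl; simp at r1)
    · exact ENNReal.inv_ne_top.2 (by rintro rfl; simp at r2)
  simp only [eNorm, h0, h1, h2, if_false]
  set a := p₀.toReal
  set b := p₁.toReal
  set c := p₂.toReal
  have key := ENNReal.lintegral_mul_norm_pow_le (μ := μ) (hF.pow_const b).aemeasurable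
    (hG.pow_const c).aemeasurable (p := a / b) (q := a / c) (by positivity) (by positivity)
    (by rw [div_eq_mul_inv, div_eq_mul_inv, ← mul_add, ← hr, mul_inv_cancel₀ r0.ne'])
  simp_rw [← ENNReal.rpow_mul, mul_div_cancel₀ _ r1.ne', mul_div_cancel₀ _ r2.ne',
    ← ENNReal.mul_rpow_of_nonneg _ _ r0.le] at key
  refine (ENNReal.rpow_le_rpow key (by positivity : 0 ≤ 1 / a)).trans_eq ?_
  rw [ENNReal.mul_rpow_of_nonneg _ _ (by positivity), ← ENNReal.rpow_mul, ← ENNReal.rpow_mul]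
  congr 2 <;> field_simp

/-- **Young's convolution inequality**. -/
theorem eNorm_convolution_le {d : ℕ} {p q r : ℝ≥0∞} (hp : 1 ≤ p) (hq : 1 ≤ q) (hr : 1 ≤ r)
    (h : p⁻¹ + q⁻¹ = 1 + r⁻¹) {a b : Ed d → ℝ≥0∞} (ha : Measurable a) (hb : Measurable b) :
    eNorm volume r (fun x => ∫⁻ y, a y * b (x - y)) ≤ eNorm volume p a * eNorm volume q b := by
  by_cases hrtop : r = ∞
  · subst hrtop
    have hle : ∀ x, ∫⁻ y, a y * b (x - y) ≤ eNorm volume p a * eNorm volume q b := by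
      intro x
      rw [← eNorm_one, ← eNorm_comp_measurePreserving (Measure.measurePreserving_sub_left volume x)
        q hb]
      exact eNorm_mul_le le_rfl (by simpa using h.symm) ha (hb.comp (measurable_const_sub x))
    simp only [eNorm, if_true] at hle ⊢
    exact essSup_le_of_ae_le _ (Filter.Eventually.of_forall hle)
  have hpi : p⁻¹ ≤ 1 := ENNReal.inv_le_one.2 hp
  have hqi : q⁻¹ ≤ 1 := ENNReal.inv_le_one.2 hq
  have hrp : r⁻¹ ≤ p⁻¹ := by
    have : 1 + r⁻¹ ≤ 1 + p⁻¹ := by rw [← h, add_comm]; gcongr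
    exact (ENNReal.add_le_add_iff_left ENNReal.one_ne_top).1 this
  have hrq : r⁻¹ ≤ q⁻¹ := by
    have : 1 + r⁻¹ ≤ 1 + q⁻¹ := by rw [← h]; gcongr
    exact (ENNReal.add_le_add_iff_left ENNReal.one_ne_top).1 this
  have hptop : p ≠ ∞ := fun hh => hrtop (top_le_iff.1 (hh ▸ ENNReal.inv_le_inv.1 hrp))
  have hqtop : q ≠ ∞ := fun hh => hrtop (top_le_iff.1 (hh ▸ ENNReal.inv_le_inv.1 hrq))
  have r0 : 0 < r.toReal := ENNReal.toReal_pos (by positivity) hrtop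
  have r1 : 0 < p.toReal := ENNReal.toReal_pos (by positivity) hptop
  have r2 : 0 < q.toReal := ENNReal.toReal_pos (by positivity) hqtop
  have fin : ∀ {s : ℝ≥0∞}, 1 ≤ s → s⁻¹ ≠ ∞ := fun hs =>
    ENNReal.inv_ne_top.2 (zero_lt_one.trans_le hs).ne'
  have hre : (p.toReal)⁻¹ + (q.toReal)⁻¹ = 1 + (r.toReal)⁻¹ := by
    have := congrArg ENNReal.toReal h
    rwa [ENNReal.toReal_add (fin hp) (fin hq), ENNReal.toReal_add ENNReal.one_ne_top (fin hr),
      ENNReal.toReal_inv, ENNReal.toReal_inv, ENNReal.toReal_inv, ENNReal.toReal_one] at this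
  have hrpe : (r.toReal)⁻¹ ≤ (p.toReal)⁻¹ := by
    rw [← ENNReal.toReal_inv, ← ENNReal.toReal_inv]; exact ENNReal.toReal_mono (fin hp) hrp
  have hrqe : (r.toReal)⁻¹ ≤ (q.toReal)⁻¹ := by
    rw [← ENNReal.toReal_inv, ← ENNReal.toReal_inv]; exact ENNReal.toReal_mono (fin hq) hrq
  simp only [eNorm, hrtop, hptop, hqtop, if_false]
  set A := p.toReal
  set B := q.toReal
  set R := r.toReal
  set IA := ∫⁻ y, a y ^ A
  set IB := ∫⁻ y, b y ^ B
  have key : ∀ x, (∫⁻ y, a y * b (x - y)) ^ R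
      ≤ (∫⁻ y, a y ^ A * b (x - y) ^ B) * (IA ^ (R * (A⁻¹ - R⁻¹)) * IB ^ (R * (B⁻¹ - R⁻¹))) := by
    intro x
    have hbx : Measurable fun y => b (x - y) := hb.comp (measurable_const_sub x)
    have hold := ENNReal.lintegral_prod_norm_pow_le (μ := (volume : Measure (Ed d)))
      (Finset.univ : Finset (Fin 3))
      (f := ![fun y => a y ^ A * b (x - y) ^ B, fun y => a y ^ A, fun y => b (x - y) ^ B])
      (by
        intro i _
        fin_cases i
        · exact ((ha.pow_const _).mul (hbx.pow_const _)).aemeasurable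
        · exact (ha.pow_const _).aemeasurable
        · exact (hbx.pow_const _).aemeasurable)
      (p := ![R⁻¹, A⁻¹ - R⁻¹, B⁻¹ - R⁻¹])
      (by simp only [Fin.sum_univ_three, Matrix.cons_val]; linarith)
      (by
        intro i _
        fin_cases i
        · simpa using r0.le
        · simpa using hrpe
        · simpa using hrqe)
    simp only [Fin.prod_univ_three, Matrix.cons_val] at hold
    have hint : ∀ y, (a y ^ A * b (x - y) ^ B) ^ R⁻¹ * (a y ^ A) ^ (A⁻¹ - R⁻¹)
        * (b (x - y) ^ B) ^ (B⁻¹ - R⁻¹) = a y * b (x - y) := by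
      intro y
      have e1 : ∀ (z : ℝ≥0∞) (s : ℝ), 0 < s → R⁻¹ ≤ s⁻¹ →
          (z ^ s) ^ R⁻¹ * (z ^ s) ^ (s⁻¹ - R⁻¹) = z := by
        intro z s hs hsr
        rw [← ENNReal.rpow_add_of_nonneg _ _ (by positivity) (by linarith), ← ENNReal.rpow_mul]
        rw [show s * (R⁻¹ + (s⁻¹ - R⁻¹)) = 1 by field_simp; ring, ENNReal.rpow_one]
      rw [ENNReal.mul_rpow_of_nonneg _ _ (by positivity), mul_right_comm ((a y ^ A) ^ R⁻¹),
        e1 _ _ r1 hrpe, mul_assoc, e1 _ _ r2 hrqe]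
    simp_rw [hint] at hold
    have hIB : ∫⁻ y, b (x - y) ^ B = IB :=
      lintegral_sub_left_eq_self (fun y => b y ^ B) x
    rw [hIB] at hold
    refine (ENNReal.rpow_le_rpow hold r0.le).trans_eq ?_
    rw [ENNReal.mul_rpow_of_nonneg _ _ r0.le, ENNReal.mul_rpow_of_nonneg _ _ r0.le,
      ← ENNReal.rpow_mul, ← ENNReal.rpow_mul, ← ENNReal.rpow_mul, inv_mul_cancel₀ r0.ne',
      ENNReal.rpow_one, mul_assoc, mul_comm _ R, mul_comm _ R]
  have hm : Measurable (Function.uncurry fun x y => a y ^ A * b (x - y) ^ B) :=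
    ((ha.comp measurable_snd).pow_const _).mul
      ((hb.comp (measurable_fst.sub measurable_snd)).pow_const _)
  have hfub : ∫⁻ x, ∫⁻ y, a y ^ A * b (x - y) ^ B = IA * IB := by
    rw [lintegral_lintegral_swap hm.aemeasurable]
    have : ∀ y, ∫⁻ x, a y ^ A * b (x - y) ^ B = a y ^ A * IB := fun y => by
      have hby : Measurable fun x => b (x - y) := hb.comp (measurable_id.sub_const y)
      rw [lintegral_const_mul _ (hby.pow_const _),
        lintegral_sub_right_eq_self (fun x => b x ^ B) y]
    simp_rw [this]
    rw [lintegral_mul_const _ (ha.pow_const _)]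
  have hint : ∫⁻ x, (∫⁻ y, a y * b (x - y)) ^ R
      ≤ (IA * IB) * (IA ^ (R * (A⁻¹ - R⁻¹)) * IB ^ (R * (B⁻¹ - R⁻¹))) := by
    refine (lintegral_mono key).trans_eq ?_
    rw [lintegral_mul_const _ hm.lintegral_prod_right, hfub]
  refine (ENNReal.rpow_le_rpow hint (by positivity : 0 ≤ 1 / R)).trans_eq ?_
  have e2 : ∀ (z : ℝ≥0∞) (s : ℝ), 0 < s → R⁻¹ ≤ s⁻¹ →
      (z * z ^ (R * (s⁻¹ - R⁻¹))) ^ (1 / R) = z ^ (1 / s) := by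
    intro z s hs hsr
    conv_lhs => rw [← ENNReal.rpow_one z, ← ENNReal.rpow_mul, one_mul]
    rw [← ENNReal.rpow_add_of_nonneg _ _ zero_le_one (mul_nonneg r0.le (by linarith)),
      ← ENNReal.rpow_mul]
    congr 1
    field_simp
    ring
  rw [mul_mul_mul_comm, ENNReal.mul_rpow_of_nonneg _ _ (by positivity), e2 _ _ r1 hrpe,
    e2 _ _ r2 hrqe]

/-- Given `p₀⁻¹ ≤ p₁⁻¹ + p₂⁻¹`, both exponents can be raised so that equality holds. -/
theorem exists_exponents_add_inv_eq {p₀ p₁ p₂ : ℝ≥0∞} (h : p₀⁻¹ ≤ p₁⁻¹ + p₂⁻¹) :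
    ∃ r₁ r₂ : ℝ≥0∞, p₁ ≤ r₁ ∧ p₂ ≤ r₂ ∧ p₀⁻¹ = r₁⁻¹ + r₂⁻¹ := by
  refine ⟨(min p₁⁻¹ p₀⁻¹)⁻¹, (p₀⁻¹ - min p₁⁻¹ p₀⁻¹)⁻¹, ?_, ?_, ?_⟩
  · rw [ENNReal.le_inv_iff_le_inv]; exact min_le_left _ _
  · rw [ENNReal.le_inv_iff_le_inv, tsub_le_iff_left]
    rcases le_total p₁⁻¹ p₀⁻¹ with h' | h'
    · rwa [min_eq_left h']
    · rw [min_eq_right h']; exact le_self_add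
  · rw [inv_inv, inv_inv, add_tsub_cancel_of_le (min_le_right _ _)]

/-- Convolution with a function in every `L^s` raises the integrability exponent. -/
theorem eNorm_convolution_le_of_le {d : ℕ} {p r : ℝ≥0∞} (hp : 1 ≤ p) (hpr : p ≤ r)
    {k : Ed d → ℝ≥0∞} (hk : Measurable k) (hfin : ∀ s : ℝ≥0∞, 1 ≤ s → eNorm volume s k < ∞) :
    ∃ C : ℝ≥0, ∀ a : Ed d → ℝ≥0∞, Measurable a →
      eNorm volume r (fun x => ∫⁻ y, a y * k (x - y)) ≤ C * eNorm volume p a := by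
  have hpi : p⁻¹ ≤ 1 := ENNReal.inv_le_one.2 hp
  have hri : r⁻¹ ≤ p⁻¹ := ENNReal.inv_le_inv.2 hpr
  have hle : p⁻¹ ≤ 1 + r⁻¹ := hpi.trans le_self_add
  have hs : 1 ≤ (1 + r⁻¹ - p⁻¹)⁻¹ := by
    rw [ENNReal.one_le_inv, tsub_le_iff_left, add_comm]
    gcongr
  refine ⟨(eNorm volume (1 + r⁻¹ - p⁻¹)⁻¹ k).toNNReal, fun a ha => ?_⟩
  rw [ENNReal.coe_toNNReal (hfin _ hs).ne, mul_comm]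
  refine eNorm_convolution_le hp hs (hp.trans hpr) ?_ ha hk
  rw [inv_inv, add_tsub_cancel_of_le hle]

theorem e2pi_add (a b : ℝ) : e2pi (a + b) = e2pi a * e2pi b := by
  simp only [e2pi, ← Complex.exp_add]
  push_cast
  ring_nf

@[simp]
theorem norm_e2pi (a : ℝ) : ‖e2pi a‖ = 1 := by
  rw [e2pi, show 2 * (Real.pi : ℂ) * I * (a : ℂ) = ((2 * Real.pi * a : ℝ) : ℂ) * I by
    push_cast; ring]
  exact Complex.norm_exp_ofReal_mul_I _

@[fun_prop]
theorem continuous_e2pi : Continuous e2pi := by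
  unfold e2pi
  fun_prop

/-- The Gaussian `e^{-b‖x‖²}`. -/
def gaussian {d : ℕ} (b : ℝ) (x : Ed d) : ℝ := Real.exp (-b * ‖x‖ ^ 2)

@[fun_prop]
theorem continuous_gaussian {d : ℕ} (b : ℝ) : Continuous (gaussian b : Ed d → ℝ) := by
  unfold gaussian
  fun_prop

theorem gaussian_pos {d : ℕ} (b : ℝ) (x : Ed d) : 0 < gaussian b x := Real.exp_pos _

theorem integrable_gaussian {d : ℕ} {b : ℝ} (hb : 0 < b) :
    Integrable (gaussian b : Ed d → ℝ) := by
  have h := GaussianFourier.integrable_cexp_neg_mul_sq_norm_add (V := Ed d) (b := (b : ℂ))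
    (by simpa using hb) 0 0
  refine h.norm.congr (Filter.Eventually.of_forall fun x => ?_)
  simp only [gaussian, zero_mul, add_zero, Complex.norm_exp]
  congr 1
  norm_cast

theorem gauss_eq {d : ℕ} (x : Ed d) : gauss d x = gaussian 1 x := by
  simp [gauss, gaussian]

theorem gauss3_eq {d : ℕ} (X : Ed d × Ed d × Ed d) :
    gauss3 d X = gaussian 1 X.1 * gaussian 1 X.2.1 * gaussian 1 X.2.2 := by
  rw [gauss3, gaussian, gaussian, gaussian, ← Complex.ofReal_mul, ← Complex.ofReal_mul,
    ← Real.exp_add, ← Real.exp_add]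
  ring_nf

/-- The Fourier transform of a Gaussian. -/
theorem exists_integral_gaussian_mul_e2pi (d : ℕ) {b : ℝ} (hb : 0 < b) :
    ∃ c : ℂ, c ≠ 0 ∧ ∀ ζ : Ed d, ∫ w, (gaussian b w : ℂ) * e2pi ⟪w, ζ⟫
      = c * gaussian (Real.pi ^ 2 / b) ζ := by
  refine ⟨((Real.pi : ℂ) / b) ^ (Module.finrank ℝ (Ed d) / 2 : ℂ), ?_, fun ζ => ?_⟩
  · rw [Ne, Complex.cpow_eq_zero_iff, not_and_or]
    exact Or.inl (div_ne_zero (by exact_mod_cast Real.pi_ne_zero) (by exact_mod_cast hb.ne'))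
  · have h := GaussianFourier.integral_cexp_neg_mul_sq_norm_add (V := Ed d) (b := (b : ℂ))
      (by simpa using hb)
      (2 * Real.pi * I) ζ
    rw [show (gaussian (Real.pi ^ 2 / b) ζ : ℂ)
      = cexp ((2 * Real.pi * I) ^ 2 * ‖ζ‖ ^ 2 / (4 * b)) by
        rw [gaussian, Complex.ofReal_exp]
        congr 1
        push_cast
        rw [mul_pow, mul_pow, I_sq]
        have : (b : ℂ) ≠ 0 := by exact_mod_cast hb.ne'
        field_simp
        ring, ← h]
    congr 1
    ext w
    rw [gaussian, e2pi, Complex.ofReal_exp, ← Complex.exp_add, real_inner_comm]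
    push_cast
    rfl

theorem eNorm_gaussian_lt_top {d : ℕ} {b : ℝ} (hb : 0 < b) {s : ℝ≥0∞} (hs : 1 ≤ s) :
    eNorm volume s (fun x : Ed d => ENNReal.ofReal (gaussian b x)) < ∞ := by
  by_cases htop : s = ∞
  · simp only [eNorm, htop, if_true]
    refine (essSup_le_of_ae_le 1 (Filter.Eventually.of_forall fun x => ?_)).trans_lt
      ENNReal.one_lt_top
    rw [ENNReal.ofReal_le_one, gaussian, Real.exp_le_one_iff]
    nlinarith [sq_nonneg ‖x‖]
  · have hs0 : 0 < s.toReal := ENNReal.toReal_pos (by positivity) htop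
    simp only [eNorm, htop, if_false]
    refine ENNReal.rpow_lt_top_of_nonneg (by positivity) (ne_of_lt ?_)
    have h := (integrable_gaussian (d := d) (mul_pos hb hs0)).lintegral_lt_top
    refine lt_of_eq_of_lt (lintegral_congr fun x => ?_) h
    rw [ENNReal.ofReal_rpow_of_pos (gaussian_pos _ _), gaussian, gaussian, ← Real.exp_mul]
    ring_nf

theorem gaussian_neg {d : ℕ} (b : ℝ) (x : Ed d) : gaussian b (-x) = gaussian b x := by
  simp [gaussian]

theorem gaussian_sub_comm {d : ℕ} (b : ℝ) (x y : Ed d) :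
    gaussian b (x - y) = gaussian b (y - x) := by
  rw [← gaussian_neg, neg_sub]

theorem gaussian_add_mul {d : ℕ} (a b : ℝ) (x : Ed d) :
    gaussian (a + b) x = gaussian a x * gaussian b x := by
  rw [gaussian, gaussian, gaussian, ← Real.exp_add]
  ring_nf

/-- The amplitude in `exists_chirp_expansion`. -/
def chirpKernel {d : ℕ} (p : Ed d × Ed d × Ed d) : ℝ :=
  Real.exp (-(‖p.1‖ ^ 2 + ‖p.2.1‖ ^ 2 - 3⁻¹ * ‖p.1 + p.2.1‖ ^ 2)) * gaussian (Real.pi ^ 2 / 2) p.2.2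

@[fun_prop]
theorem continuous_chirpKernel {d : ℕ} : Continuous (chirpKernel (d := d)) := by
  unfold chirpKernel
  fun_prop

theorem chirpKernel_nonneg {d : ℕ} (p : Ed d × Ed d × Ed d) : 0 ≤ chirpKernel p :=
  mul_nonneg (Real.exp_pos _).le (gaussian_pos _ _).le

theorem chirpKernel_le {d : ℕ} (p : Ed d × Ed d × Ed d) :
    chirpKernel p ≤ gaussian 3⁻¹ p.1 * (gaussian 3⁻¹ p.2.1 * gaussian (Real.pi ^ 2 / 2) p.2.2) := by
  rw [← mul_assoc, chirpKernel]
  refine mul_le_mul_of_nonneg_right ?_ (gaussian_pos _ _).le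
  rw [gaussian, gaussian, ← Real.exp_add, Real.exp_le_exp]
  have h := parallelogram_law_with_norm ℝ p.1 p.2.1
  nlinarith [sq_nonneg ‖p.1 - p.2.1‖]

theorem integrable_chirpKernel (d : ℕ) : Integrable (chirpKernel (d := d)) := by
  have h : Integrable fun p : Ed d × Ed d × Ed d =>
      gaussian 3⁻¹ p.1 * (gaussian 3⁻¹ p.2.1 * gaussian (Real.pi ^ 2 / 2) p.2.2) :=
    (integrable_gaussian (by norm_num)).mul_prod
      ((integrable_gaussian (by norm_num)).mul_prod (integrable_gaussian (by positivity)))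
  refine h.mono' continuous_chirpKernel.aestronglyMeasurable
    (Filter.Eventually.of_forall fun p => ?_)
  rw [Real.norm_of_nonneg (chirpKernel_nonneg p)]
  exact chirpKernel_le p

/-- The chirped Gaussian `e^{-|z|²-(1+π²)(|ζ₁|²+|ζ₂|²)} e^{2πi z·(ζ₁+ζ₂)}` is an absolutely
convergent superposition of time-frequency shifts of the Gaussian. -/
theorem exists_chirp_expansion (d : ℕ) :
    ∃ c : ℂ, ∀ z ζ₁ ζ₂ : Ed d,
      (gaussian 1 z * gaussian (1 + Real.pi ^ 2) ζ₁ * gaussian (1 + Real.pi ^ 2) ζ₂ : ℂ)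
          * e2pi ⟪z, ζ₁ + ζ₂⟫
        = c * ∫ p : Ed d × Ed d × Ed d, (chirpKernel p : ℂ) *
            gauss3 d (z - (3⁻¹ : ℝ) • (p.1 + p.2.1), ζ₁, ζ₂) *
            e2pi (⟪p.1, ζ₁⟫ + ⟪p.2.1, ζ₂⟫ + ⟪p.2.2, z - (3⁻¹ : ℝ) • (p.1 + p.2.1)⟫) := by
  obtain ⟨c₁, hc₁, h₁⟩ := exists_integral_gaussian_mul_e2pi d (b := 1) one_pos
  obtain ⟨c₂, hc₂, h₂⟩ := exists_integral_gaussian_mul_e2pi d (b := Real.pi ^ 2 / 2) (by positivity)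
  rw [show Real.pi ^ 2 / (Real.pi ^ 2 / 2) = 2 by field_simp] at h₂
  rw [div_one] at h₁
  refine ⟨(c₁ * c₁ * c₂)⁻¹, fun z ζ₁ ζ₂ => ?_⟩
  rw [eq_inv_mul_iff_mul_eq₀ (by simp [hc₁, hc₂])]
  have hshift : ∀ ζ : Ed d, ∫ w, (gaussian 1 (w - z) : ℂ) * e2pi ⟪w, ζ⟫
      = c₁ * gaussian (Real.pi ^ 2) ζ * e2pi ⟪z, ζ⟫ := by
    intro ζ
    rw [← integral_add_right_eq_self _ z, ← h₁, ← integral_mul_const]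
    congr 1
    ext w
    rw [add_sub_cancel_right, inner_add_left, e2pi_add, mul_assoc]
  have hint : Integrable fun p : Ed d × Ed d × Ed d => (chirpKernel p : ℂ) *
      gauss3 d (z - (3⁻¹ : ℝ) • (p.1 + p.2.1), ζ₁, ζ₂) *
      e2pi (⟪p.1, ζ₁⟫ + ⟪p.2.1, ζ₂⟫ + ⟪p.2.2, z - (3⁻¹ : ℝ) • (p.1 + p.2.1)⟫) := by
    refine (integrable_chirpKernel d).mono' ?_ (Filter.Eventually.of_forall fun p => ?_)
    · simp only [gauss3_eq]
      refine Continuous.aestronglyMeasurable ?_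
      fun_prop
    · rw [norm_mul, norm_mul, norm_e2pi, mul_one, Complex.norm_real,
        Real.norm_of_nonneg (chirpKernel_nonneg p)]
      refine mul_le_of_le_one_right (chirpKernel_nonneg p) ?_
      rw [gauss3, Complex.norm_real, Real.norm_of_nonneg (Real.exp_pos _).le, Real.exp_le_one_iff]
      nlinarith [sq_nonneg ‖z - (3⁻¹ : ℝ) • (p.1 + p.2.1)‖, sq_nonneg ‖ζ₁‖, sq_nonneg ‖ζ₂‖]
  have hsq : ∀ w₁ w₂ : Ed d,
      Real.exp (-(‖w₁‖ ^ 2 + ‖w₂‖ ^ 2 - 3⁻¹ * ‖w₁ + w₂‖ ^ 2))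
          * gaussian 1 (z - (3⁻¹ : ℝ) • (w₁ + w₂)) * gaussian 2 (z - (3⁻¹ : ℝ) • (w₁ + w₂))
        = gaussian 1 z * gaussian 1 (w₁ - z) * gaussian 1 (w₂ - z) := by
    intro w₁ w₂
    simp only [gaussian, ← Real.exp_add]
    congr 1
    simp only [@norm_sub_sq ℝ, @norm_add_sq ℝ, norm_smul, inner_smul_right, inner_add_right,
      mul_pow, RCLike.re_to_real, real_inner_comm z]
    norm_num
    ring
  have hinner : ∀ w₁ w₂ : Ed d, ∫ u : Ed d, (chirpKernel (w₁, w₂, u) : ℂ) *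
      gauss3 d (z - (3⁻¹ : ℝ) • (w₁ + w₂), ζ₁, ζ₂) *
      e2pi (⟪w₁, ζ₁⟫ + ⟪w₂, ζ₂⟫ + ⟪u, z - (3⁻¹ : ℝ) • (w₁ + w₂)⟫)
      = (c₂ * gaussian 1 z * gaussian 1 ζ₁ * gaussian 1 ζ₂) *
        ((gaussian 1 (w₁ - z) * e2pi ⟪w₁, ζ₁⟫) * (gaussian 1 (w₂ - z) * e2pi ⟪w₂, ζ₂⟫)) := by
    intro w₁ w₂
    have h3 := congrArg (fun r : ℝ => (r : ℂ)) (hsq w₁ w₂)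
    push_cast at h3
    calc _ = ∫ u : Ed d, (cexp (-(‖w₁‖ ^ 2 + ‖w₂‖ ^ 2 - 3⁻¹ * ‖w₁ + w₂‖ ^ 2))
          * gaussian 1 (z - (3⁻¹ : ℝ) • (w₁ + w₂)) * gaussian 1 ζ₁ * gaussian 1 ζ₂
          * e2pi ⟪w₁, ζ₁⟫ * e2pi ⟪w₂, ζ₂⟫) *
          (gaussian (Real.pi ^ 2 / 2) u * e2pi ⟪u, z - (3⁻¹ : ℝ) • (w₁ + w₂)⟫) := by
          congr 1
          ext u
          rw [chirpKernel, gauss3_eq, e2pi_add, e2pi_add]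
          push_cast
          ring
      _ = _ := by
          rw [integral_const_mul, h₂]
          linear_combination (c₂ * gaussian 1 ζ₁ * gaussian 1 ζ₂ * e2pi ⟪w₁, ζ₁⟫ *
            e2pi ⟪w₂, ζ₂⟫) * h3
  symm
  calc _ = ∫ w₁ : Ed d, ∫ q : Ed d × Ed d, (chirpKernel (w₁, q) : ℂ) *
      gauss3 d (z - (3⁻¹ : ℝ) • (w₁ + q.1), ζ₁, ζ₂) *
      e2pi (⟪w₁, ζ₁⟫ + ⟪q.1, ζ₂⟫ + ⟪q.2, z - (3⁻¹ : ℝ) • (w₁ + q.1)⟫) :=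
        integral_prod _ hint
    _ = ∫ w₁ : Ed d, ∫ w₂ : Ed d, ∫ u : Ed d, (chirpKernel (w₁, w₂, u) : ℂ) *
      gauss3 d (z - (3⁻¹ : ℝ) • (w₁ + w₂), ζ₁, ζ₂) *
      e2pi (⟪w₁, ζ₁⟫ + ⟪w₂, ζ₂⟫ + ⟪u, z - (3⁻¹ : ℝ) • (w₁ + w₂)⟫) := by
        refine integral_congr_ae ?_
        filter_upwards [hint.prod_right_ae] with w₁ hw
        exact integral_prod _ hw
    _ = _ := by
        simp_rw [hinner, integral_const_mul, hshift, integral_mul_const, hshift]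
        rw [gaussian_add_mul, gaussian_add_mul, inner_add_right, e2pi_add]
        push_cast
        ring

theorem integrable_mul_translate {E P : Type*} [AddGroup E] [MeasurableSpace E]
    [MeasurableAdd₂ E] [MeasurableNeg E] [MeasurableSpace P] {μ : Measure E} {ρ : Measure P}
    [SFinite μ] [SFinite ρ] [μ.IsAddRightInvariant] {G : E → ℝ} {K : P → ℝ} {φ : P → E}
    (hG : Integrable G μ) (hGm : Measurable G) (hK : Integrable K ρ) (hφ : Measurable φ) :
    Integrable (fun z : E × P => K z.2 * G (z.1 - φ z.2)) (μ.prod ρ) := by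
  have hm : AEStronglyMeasurable (fun z : E × P => K z.2 * G (z.1 - φ z.2)) (μ.prod ρ) :=
    hK.aestronglyMeasurable.comp_snd.mul
      (hGm.comp (measurable_fst.sub (hφ.comp measurable_snd))).aestronglyMeasurable
  refine (integrable_prod_iff' hm).2 ⟨Filter.Eventually.of_forall fun p => ?_, ?_⟩
  · exact (hG.comp_sub_right (φ p)).const_mul (K p)
  · have : ∀ p, ∫ x, ‖K p * G (x - φ p)‖ ∂μ = ‖K p‖ * ∫ x, ‖G x‖ ∂μ := fun p => by
      simp_rw [norm_mul]
      rw [integral_const_mul, integral_sub_right_eq_self (fun x => ‖G x‖)]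
    simp_rw [this]
    exact hK.norm.mul_const _

theorem integrable_stft_integrand {d : ℕ} {f : Ed d → ℂ} (hf : Integrable f) (hfc : Continuous f)
    (ξ η : Ed d) :
    Integrable fun z : Ed d × Ed d =>
      e2pi ⟪z.1, ξ⟫ * (f z.2 * e2pi (-⟪z.2, η⟫) * gauss d (z.2 - z.1)) := by
  have h := integrable_mul_translate (μ := (volume : Measure (Ed d))) (ρ := volume)
    (integrable_gaussian (d := d) one_pos) (continuous_gaussian 1).measurable hf.norm
    (φ := fun y => y) measurable_id
  refine h.mono' ?_ (Filter.Eventually.of_forall fun z => ?_)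
  · simp only [gauss_eq]
    refine Continuous.aestronglyMeasurable ?_
    fun_prop
  · rw [norm_mul, norm_mul, norm_mul, norm_e2pi, norm_e2pi, gauss_eq, Complex.norm_real,
      Real.norm_of_nonneg (gaussian_pos _ _).le, ← neg_sub, gaussian_neg]
    simp

theorem integrable_stft {d : ℕ} {f : Ed d → ℂ} (hf : Integrable f) (hfc : Continuous f)
    (η : Ed d) : Integrable fun s => STFT d (gauss d) f s η := by
  have h := (integrable_stft_integrand hf hfc 0 η).integral_prod_left
  refine h.congr (Filter.Eventually.of_forall fun s => ?_)
  simp [STFT, e2pi]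

theorem exists_FT_mul_gaussian_eq (d : ℕ) :
    ∃ c : ℂ, ∀ f : Ed d → ℂ, Integrable f → Continuous f → ∀ ξ η : Ed d,
      FT d f ξ * gaussian (Real.pi ^ 2) (ξ - η)
        = c * ∫ s, e2pi ⟪s, η - ξ⟫ * STFT d (gauss d) f s η := by
  obtain ⟨c, hc, h⟩ := exists_integral_gaussian_mul_e2pi d (b := 1) one_pos
  rw [div_one] at h
  refine ⟨c⁻¹, fun f hf hfc ξ η => ?_⟩
  rw [eq_inv_mul_iff_mul_eq₀ hc]
  symm
  have hin : ∀ y : Ed d, ∫ s, e2pi ⟪s, η - ξ⟫ * gauss d (y - s)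
      = c * gaussian (Real.pi ^ 2) (ξ - η) * e2pi ⟪y, η - ξ⟫ := by
    intro y
    rw [← integral_sub_left_eq_self _ volume y, ← gaussian_neg, neg_sub, ← h,
      ← integral_mul_const, ← integral_neg_eq_self]
    congr 1
    ext s
    rw [sub_sub_cancel, sub_neg_eq_add, inner_add_left, e2pi_add, gauss_eq, gaussian_neg]
    ring
  calc ∫ s, e2pi ⟪s, η - ξ⟫ * STFT d (gauss d) f s η
      = ∫ s, ∫ y, e2pi ⟪s, η - ξ⟫ * (f y * e2pi (-⟪y, η⟫) * gauss d (y - s)) := by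
        simp_rw [STFT, integral_const_mul]
    _ = ∫ y, ∫ s, e2pi ⟪s, η - ξ⟫ * (f y * e2pi (-⟪y, η⟫) * gauss d (y - s)) :=
        integral_integral_swap (integrable_stft_integrand hf hfc _ η)
    _ = ∫ y, (f y * e2pi (-⟪y, ξ⟫)) * (c * gaussian (Real.pi ^ 2) (ξ - η)) := by
        congr 1
        ext y
        calc _ = ∫ s, (f y * e2pi (-⟪y, η⟫)) * (e2pi ⟪s, η - ξ⟫ * gauss d (y - s)) := by
              congr 1; ext s; ring
          _ = _ := by
              rw [integral_const_mul, hin, show -⟪y, ξ⟫ = -⟪y, η⟫ + ⟪y, η - ξ⟫ by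
                rw [inner_sub_right]; ring, e2pi_add]
              ring
    _ = _ := by rw [integral_mul_const, FT]; ring

theorem FT_schwartz_eq {d : ℕ} (f : SchwartzMap (Ed d) ℂ) :
    FT d f = FourierTransform.fourier f := by
  ext ξ
  rw [SchwartzMap.fourier_coe, Real.fourier_eq, FT]
  congr 1
  ext y
  rw [Circle.smul_def, Real.fourierChar_apply, smul_eq_mul, mul_comm, e2pi]
  push_cast
  ring_nf

theorem integrable_FT_schwartz {d : ℕ} (f : SchwartzMap (Ed d) ℂ) : Integrable (FT d f) := by
  rw [FT_schwartz_eq]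
  exact SchwartzMap.integrable _

theorem measurable_stft {d : ℕ} {f : Ed d → ℂ} (hf : Measurable f) :
    Measurable fun z : Ed d × Ed d => STFT d (gauss d) f z.1 z.2 := by
  have hm : Measurable fun w : (Ed d × Ed d) × Ed d =>
      f w.2 * e2pi (-⟪w.2, w.1.2⟫) * gauss d (w.2 - w.1.1) := by
    simp only [gauss_eq]
    refine ((hf.comp measurable_snd).mul ?_).mul ?_
    · exact Continuous.measurable (by fun_prop)
    · exact Continuous.measurable (by fun_prop)
  exact hm.stronglyMeasurable.integral_prod_right.measurable

set_option synthInstance.maxSize 1024 in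
set_option synthInstance.maxHeartbeats 400000 in
theorem measurable_symbSTFT {d : ℕ} {σ : Ed d × Ed d × Ed d → ℂ} (hσ : Measurable σ) :
    Measurable fun z : Ed d × Ed d × Ed d × Ed d × Ed d × Ed d =>
      symbSTFT d (gauss3 d) σ z.1 z.2.1 z.2.2.1 z.2.2.2.1 z.2.2.2.2.1 z.2.2.2.2.2 := by
  have hm : Measurable fun w : (Ed d × Ed d × Ed d × Ed d × Ed d × Ed d) × (Ed d × Ed d × Ed d) =>
      σ w.2 * gauss3 d (w.2.1 - w.1.1, w.2.2.1 - w.1.2.2.2.1, w.2.2.2 - w.1.2.2.2.2.1) *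
      e2pi (-(⟪w.2.1, w.1.2.2.2.2.2⟫ - ⟪w.1.2.1, w.2.2.1⟫ - ⟪w.1.2.2.1, w.2.2.2⟫)) := by
    simp only [gauss3_eq]
    refine ((hσ.comp measurable_snd).mul ?_).mul ?_
    · exact Continuous.measurable (by fun_prop)
    · exact Continuous.measurable (by fun_prop)
  exact hm.stronglyMeasurable.integral_prod_right.measurable

instance isAddRightInvariant_volume_prod {G H : Type*} [Add G] [Add H] [MeasureSpace G]
    [MeasureSpace H] [MeasurableAdd G] [MeasurableAdd H]
    [SFinite (volume : Measure G)] [SFinite (volume : Measure H)]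
    [(volume : Measure G).IsAddRightInvariant] [(volume : Measure H).IsAddRightInvariant] :
    (volume : Measure (G × H)).IsAddRightInvariant :=
  Measure.prod.instIsAddRightInvariant

set_option synthInstance.maxSize 1024 in
set_option synthInstance.maxHeartbeats 400000 in
theorem exists_enorm_chirped_symbol_integral_le (d : ℕ) :
    ∃ C : ℝ≥0, ∀ σ : Ed d × Ed d × Ed d → ℂ, Measurable σ → (∃ M : ℝ, ∀ X, ‖σ X‖ ≤ M) →
      ∀ t ν η₁ η₂ s₁ s₂ : Ed d,
      ‖∫ X : Ed d × Ed d × Ed d, σ X * (gaussian 1 (X.1 - t)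
          * gaussian (1 + Real.pi ^ 2) (X.2.1 - η₁) * gaussian (1 + Real.pi ^ 2) (X.2.2 - η₂)) *
          e2pi (⟪X.1, X.2.1 + X.2.2⟫ - ⟪X.1, ν⟫ + ⟪s₁, η₁ - X.2.1⟫ + ⟪s₂, η₂ - X.2.2⟫)‖ₑ
        ≤ C * ∫⁻ p : Ed d × Ed d × Ed d, ENNReal.ofReal (chirpKernel p) *
          ‖symbSTFT d (gauss3 d) σ (t + (3⁻¹ : ℝ) • (p.1 + p.2.1)) (t - s₁ + p.1) (t - s₂ + p.2.1)
            η₁ η₂ (ν - η₁ - η₂ - p.2.2)‖ₑ := by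
  obtain ⟨c, hc⟩ := exists_chirp_expansion d
  refine ⟨‖c‖₊, fun σ hσ ⟨M, hM⟩ t ν η₁ η₂ s₁ s₂ => ?_⟩
  let θ : Ed d × Ed d × Ed d → ℝ := fun p =>
    -⟪p.1, η₁⟫ - ⟪p.2.1, η₂⟫ - ⟪p.2.2, t + (3⁻¹ : ℝ) • (p.1 + p.2.1)⟫ - ⟪t, η₁⟫ - ⟪t, η₂⟫
      + ⟪s₁, η₁⟫ + ⟪s₂, η₂⟫
  let Ψ : (Ed d × Ed d × Ed d) × (Ed d × Ed d × Ed d) → ℂ := fun z =>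
    (chirpKernel z.2 * e2pi (θ z.2)) *
      (σ z.1 * gauss3 d (z.1.1 - (t + (3⁻¹ : ℝ) • (z.2.1 + z.2.2.1)), z.1.2.1 - η₁, z.1.2.2 - η₂) *
      e2pi (-(⟪z.1.1, ν - η₁ - η₂ - z.2.2.2⟫ - ⟪t - s₁ + z.2.1, z.1.2.1⟫
        - ⟪t - s₂ + z.2.2.1, z.1.2.2⟫)))
  have hG : Integrable fun X : Ed d × Ed d × Ed d =>
      gaussian 1 X.1 * (gaussian 1 X.2.1 * gaussian 1 X.2.2) :=
    (integrable_gaussian one_pos).mul_prod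
      ((integrable_gaussian one_pos).mul_prod (integrable_gaussian one_pos))
  have hΨ : Integrable Ψ := by
    have h := integrable_mul_translate (μ := (volume : Measure (Ed d × Ed d × Ed d)))
      (ρ := (volume : Measure (Ed d × Ed d × Ed d))) hG
      (Continuous.measurable (by fun_prop)) ((integrable_chirpKernel d).const_mul M)
      (φ := fun p => (t + (3⁻¹ : ℝ) • (p.1 + p.2.1), η₁, η₂)) (Continuous.measurable (by fun_prop))
    refine h.mono' ?_ (Filter.Eventually.of_forall fun z => ?_)
    · simp only [Ψ, θ, gauss3_eq]
      refine AEStronglyMeasurable.mul (Continuous.aestronglyMeasurable (by fun_prop)) ?_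
      refine AEStronglyMeasurable.mul (AEStronglyMeasurable.mul ?_ ?_) ?_
      · exact (hσ.comp measurable_fst).aestronglyMeasurable
      · exact Continuous.aestronglyMeasurable (by fun_prop)
      · exact Continuous.aestronglyMeasurable (by fun_prop)
    · simp only [Ψ, norm_mul, norm_e2pi, mul_one, gauss3_eq, Complex.norm_real,
        Real.norm_of_nonneg (chirpKernel_nonneg _), Real.norm_of_nonneg (gaussian_pos _ _).le,
        Prod.fst_sub, Prod.snd_sub]
      rw [← mul_assoc, mul_comm M, mul_assoc _ M, mul_assoc (chirpKernel _),
        mul_assoc (gaussian _ _)]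
      refine mul_le_mul_of_nonneg_left (mul_le_mul_of_nonneg_right (hM _) ?_)
        (chirpKernel_nonneg _)
      exact (mul_pos (gaussian_pos _ _) (mul_pos (gaussian_pos _ _) (gaussian_pos _ _))).le
  have heq : ∫ X : Ed d × Ed d × Ed d, σ X * (gaussian 1 (X.1 - t)
          * gaussian (1 + Real.pi ^ 2) (X.2.1 - η₁) * gaussian (1 + Real.pi ^ 2) (X.2.2 - η₂)) *
          e2pi (⟪X.1, X.2.1 + X.2.2⟫ - ⟪X.1, ν⟫ + ⟪s₁, η₁ - X.2.1⟫ + ⟪s₂, η₂ - X.2.2⟫)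
      = c * ∫ X, ∫ p, Ψ (X, p) := by
    rw [← integral_const_mul]
    congr 1
    ext X
    have hph : (⟪X.1, X.2.1 + X.2.2⟫ - ⟪X.1, ν⟫ + ⟪s₁, η₁ - X.2.1⟫ + ⟪s₂, η₂ - X.2.2⟫ : ℝ)
        = ⟪X.1 - t, (X.2.1 - η₁) + (X.2.2 - η₂)⟫ + (⟪t, X.2.1⟫ + ⟪t, X.2.2⟫ + ⟪X.1, η₁⟫ + ⟪X.1, η₂⟫
          - ⟪t, η₁⟫ - ⟪t, η₂⟫ - ⟪X.1, ν⟫ + ⟪s₁, η₁ - X.2.1⟫ + ⟪s₂, η₂ - X.2.2⟫) := by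
      simp only [inner_add_right, inner_sub_right, inner_sub_left]
      ring
    rw [hph, e2pi_add]
    calc _ = σ X * ((gaussian 1 (X.1 - t) * gaussian (1 + Real.pi ^ 2) (X.2.1 - η₁)
            * gaussian (1 + Real.pi ^ 2) (X.2.2 - η₂)) *
            e2pi ⟪X.1 - t, (X.2.1 - η₁) + (X.2.2 - η₂)⟫) *
            e2pi (⟪t, X.2.1⟫ + ⟪t, X.2.2⟫ + ⟪X.1, η₁⟫ + ⟪X.1, η₂⟫
          - ⟪t, η₁⟫ - ⟪t, η₂⟫ - ⟪X.1, ν⟫ + ⟪s₁, η₁ - X.2.1⟫ + ⟪s₂, η₂ - X.2.2⟫) := by ring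
      _ = _ := by
        rw [hc, ← mul_assoc, mul_comm (σ X), mul_assoc, mul_assoc, ← integral_const_mul,
          ← integral_mul_const, ← integral_const_mul, ← integral_const_mul]
        congr 1
        ext p
        simp only [Ψ]
        rw [sub_sub]
        have hph2 : (⟪p.1, X.2.1 - η₁⟫ + ⟪p.2.1, X.2.2 - η₂⟫
              + ⟪p.2.2, X.1 - (t + (3⁻¹ : ℝ) • (p.1 + p.2.1))⟫)
            + (⟪t, X.2.1⟫ + ⟪t, X.2.2⟫ + ⟪X.1, η₁⟫ + ⟪X.1, η₂⟫
          - ⟪t, η₁⟫ - ⟪t, η₂⟫ - ⟪X.1, ν⟫ + ⟪s₁, η₁ - X.2.1⟫ + ⟪s₂, η₂ - X.2.2⟫)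
          = θ p + -(⟪X.1, ν - η₁ - η₂ - p.2.2⟫ - ⟪t - s₁ + p.1, X.2.1⟫
            - ⟪t - s₂ + p.2.1, X.2.2⟫) := by
          simp only [θ, inner_add_right, inner_sub_right, inner_sub_left, inner_add_left,
            real_inner_comm X.1 p.2.2]
          ring
        have := congrArg e2pi hph2
        rw [e2pi_add (_ + _ + ⟪p.2.2, _⟫), e2pi_add (θ p)] at this
        linear_combination (c * σ X * chirpKernel p *
          gauss3 d (X.1 - (t + (3⁻¹ : ℝ) • (p.1 + p.2.1)), X.2.1 - η₁, X.2.2 - η₂)) * this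
  rw [heq, integral_integral_swap hΨ, enorm_mul]
  refine mul_le_mul' le_rfl
    ((enorm_integral_le_lintegral_enorm _).trans (lintegral_mono fun p => ?_))
  simp only [Ψ]
  rw [integral_const_mul, enorm_mul, enorm_mul, ← symbSTFT]
  refine mul_le_mul' (le_of_eq ?_) le_rfl
  rw [← ofReal_norm (e2pi _), norm_e2pi, ← ofReal_norm, Complex.norm_real,
    Real.norm_of_nonneg (chirpKernel_nonneg _)]
  simp

theorem exists_enorm_integral_le_lintegral_localized (d : ℕ) {b : ℝ} (hb : 0 < b) :
    ∃ C : ℝ≥0, ∀ H : Ed d × Ed d × Ed d → ℂ, Integrable H →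
      ‖∫ X, H X‖ₑ ≤ C * ∫⁻ η : Ed d × Ed d,
        ‖∫ X, H X * (gaussian b (X.2.1 - η.1) * gaussian b (X.2.2 - η.2) : ℝ)‖ₑ := by
  let G : Ed d × Ed d → ℝ := fun η => gaussian b η.1 * gaussian b η.2
  have hGc : Continuous G := by fun_prop
  have hG : Integrable G := (integrable_gaussian hb).mul_prod (integrable_gaussian hb)
  obtain ⟨c, hc, h⟩ := exists_integral_gaussian_mul_e2pi d hb
  have hK : (∫ η, (G η : ℂ)) = c * c := by
    have h0 : ∫ w : Ed d, (gaussian b w : ℂ) = c := by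
      simpa [e2pi, gaussian] using h 0
    simp only [G, ofReal_mul]
    rw [Measure.volume_eq_prod,
      integral_prod_mul (fun w : Ed d => (gaussian b w : ℂ))
        (fun w : Ed d => (gaussian b w : ℂ)), h0]
  refine ⟨‖(c * c)⁻¹‖₊, fun H hH => ?_⟩
  have hint : Integrable fun z : (Ed d × Ed d) × (Ed d × Ed d × Ed d) =>
      H z.2 * (gaussian b (z.2.2.1 - z.1.1) * gaussian b (z.2.2.2 - z.1.2) : ℝ) := by
    have h := integrable_mul_translate (μ := (volume : Measure (Ed d × Ed d)))
      (ρ := (volume : Measure (Ed d × Ed d × Ed d))) hG hGc.measurable hH.norm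
      (φ := fun X => X.2) measurable_snd
    refine h.mono' ?_ (Filter.Eventually.of_forall fun z => ?_)
    · refine (hH.aestronglyMeasurable.comp_snd).mul ?_
      exact Continuous.aestronglyMeasurable (by fun_prop)
    · rw [norm_mul, Complex.norm_real, Real.norm_of_nonneg
        (mul_pos (gaussian_pos _ _) (gaussian_pos _ _)).le]
      simp only [G, Prod.fst_sub, Prod.snd_sub]
      rw [gaussian_sub_comm, gaussian_sub_comm b z.2.2.2]
  have heq : c * c * ∫ X, H X = ∫ η : Ed d × Ed d,
      ∫ X, H X * (gaussian b (X.2.1 - η.1) * gaussian b (X.2.2 - η.2) : ℝ) := by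
    rw [integral_integral_swap hint, mul_comm, ← integral_mul_const]
    congr 1
    ext X
    rw [integral_const_mul, ← hK, ← integral_sub_right_eq_self _ X.2]
    simp only [G, Prod.fst_sub, Prod.snd_sub, gaussian_sub_comm b X.2.1, gaussian_sub_comm b X.2.2]
  rw [← inv_mul_cancel_left₀ (mul_ne_zero hc hc) (∫ X, H X), heq, enorm_mul]
  exact mul_le_mul' le_rfl (enorm_integral_le_lintegral_enorm _)

theorem integrable_stft_biOp_integrand {d : ℕ} {σ : Ed d × Ed d × Ed d → ℂ} (hσ : Measurable σ)
    {M : ℝ} (hM : ∀ X, ‖σ X‖ ≤ M) {F₁ F₂ : Ed d → ℂ} (hF₁ : Integrable F₁) (hF₂ : Integrable F₂)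
    (t ν : Ed d) :
    Integrable fun X : Ed d × Ed d × Ed d =>
      σ X * (gaussian 1 (X.1 - t) * (F₁ X.2.1 * F₂ X.2.2)) *
        e2pi (⟪X.1, X.2.1 + X.2.2⟫ - ⟪X.1, ν⟫) := by
  have h : Integrable fun X : Ed d × Ed d × Ed d =>
      (gaussian 1 (X.1 - t) : ℂ) * (F₁ X.2.1 * F₂ X.2.2) :=
    ((integrable_gaussian one_pos).comp_sub_right t).ofReal.mul_prod (hF₁.mul_prod hF₂)
  refine (h.bdd_mul (c := M) hσ.aestronglyMeasurable (Filter.Eventually.of_forall hM)).mul_bdd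
    (c := 1) (Continuous.aestronglyMeasurable (by fun_prop))
    (Filter.Eventually.of_forall fun X => (norm_e2pi _).le)

theorem stft_biOp_eq {d : ℕ} {σ : Ed d × Ed d × Ed d → ℂ} (hσ : Measurable σ)
    {M : ℝ} (hM : ∀ X, ‖σ X‖ ≤ M) {f₁ f₂ : Ed d → ℂ} (hF₁ : Integrable (FT d f₁))
    (hF₂ : Integrable (FT d f₂)) (t ν : Ed d) :
    STFT d (gauss d) (biOp d σ f₁ f₂) t ν = ∫ X : Ed d × Ed d × Ed d,
      σ X * (gaussian 1 (X.1 - t) * (FT d f₁ X.2.1 * FT d f₂ X.2.2)) *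
        e2pi (⟪X.1, X.2.1 + X.2.2⟫ - ⟪X.1, ν⟫) := by
  refine Eq.trans ?_ (integral_prod _ (integrable_stft_biOp_integrand hσ hM hF₁ hF₂ t ν)).symm
  rw [STFT]
  congr 1
  ext x
  rw [biOp, ← integral_mul_const, ← integral_mul_const]
  congr 1
  ext ξ
  rw [sub_eq_add_neg (⟪x, ξ.1 + ξ.2⟫ : ℝ), e2pi_add, gauss_eq]
  ring

set_option synthInstance.maxSize 1024 in
set_option synthInstance.maxHeartbeats 400000 in
theorem exists_enorm_localized_integral_le (d : ℕ) :
    ∃ C : ℝ≥0, ∀ σ : Ed d × Ed d × Ed d → ℂ, Measurable σ → (∃ M : ℝ, ∀ X, ‖σ X‖ ≤ M) →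
      ∀ f₁ f₂ : Ed d → ℂ, Integrable f₁ → Continuous f₁ → Integrable f₂ → Continuous f₂ →
      ∀ t ν η₁ η₂ : Ed d,
      ‖∫ X : Ed d × Ed d × Ed d, σ X * (gaussian 1 (X.1 - t) * (FT d f₁ X.2.1 * FT d f₂ X.2.2)) *
        e2pi (⟪X.1, X.2.1 + X.2.2⟫ - ⟪X.1, ν⟫) *
          (gaussian (Real.pi ^ 2 + (1 + Real.pi ^ 2)) (X.2.1 - η₁)
          * gaussian (Real.pi ^ 2 + (1 + Real.pi ^ 2)) (X.2.2 - η₂) : ℝ)‖ₑ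
      ≤ C * ∫⁻ s : Ed d × Ed d, ‖STFT d (gauss d) f₁ s.1 η₁‖ₑ * ‖STFT d (gauss d) f₂ s.2 η₂‖ₑ *
        ‖∫ X : Ed d × Ed d × Ed d, σ X * (gaussian 1 (X.1 - t)
          * gaussian (1 + Real.pi ^ 2) (X.2.1 - η₁) * gaussian (1 + Real.pi ^ 2) (X.2.2 - η₂)) *
          e2pi (⟪X.1, X.2.1 + X.2.2⟫ - ⟪X.1, ν⟫ + ⟪s.1, η₁ - X.2.1⟫ + ⟪s.2, η₂ - X.2.2⟫)‖ₑ := by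
  obtain ⟨c, hc⟩ := exists_FT_mul_gaussian_eq d
  refine ⟨‖c * c‖₊, fun σ hσ ⟨M, hM⟩ f₁ f₂ hf₁ hc₁ hf₂ hc₂ t ν η₁ η₂ => ?_⟩
  let P : Ed d × Ed d × Ed d → ℂ := fun X => σ X * (gaussian 1 (X.1 - t)
          * gaussian (1 + Real.pi ^ 2) (X.2.1 - η₁) * gaussian (1 + Real.pi ^ 2) (X.2.2 - η₂))
  let V : Ed d × Ed d → ℂ := fun s => STFT d (gauss d) f₁ s.1 η₁ * STFT d (gauss d) f₂ s.2 η₂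
  let Q : (Ed d × Ed d × Ed d) × (Ed d × Ed d) → ℂ := fun z => P z.1 * V z.2 *
    e2pi (⟪z.1.1, z.1.2.1 + z.1.2.2⟫ - ⟪z.1.1, ν⟫ + ⟪z.2.1, η₁ - z.1.2.1⟫ + ⟪z.2.2, η₂ - z.1.2.2⟫)
  have hP : Integrable P := by
    have hb : (0 : ℝ) < 1 + Real.pi ^ 2 := by positivity
    have h : Integrable fun X : Ed d × Ed d × Ed d => (gaussian 1 (X.1 - t) : ℂ)
        * ((gaussian (1 + Real.pi ^ 2) (X.2.1 - η₁) : ℂ) *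
          (gaussian (1 + Real.pi ^ 2) (X.2.2 - η₂) : ℂ)) :=
      ((integrable_gaussian one_pos).comp_sub_right t).ofReal.mul_prod
        (((integrable_gaussian hb).comp_sub_right η₁).ofReal.mul_prod
          ((integrable_gaussian hb).comp_sub_right η₂).ofReal)
    simp only [← mul_assoc] at h
    exact h.bdd_mul (c := M) hσ.aestronglyMeasurable (Filter.Eventually.of_forall hM)
  have hQ : Integrable Q :=
    (hP.mul_prod ((integrable_stft hf₁ hc₁ η₁).mul_prod (integrable_stft hf₂ hc₂ η₂))).mul_bdd
      (c := 1) (Continuous.aestronglyMeasurable (by fun_prop))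
      (Filter.Eventually.of_forall fun X => (norm_e2pi _).le)
  have heq : ∫ X : Ed d × Ed d × Ed d,
        σ X * (gaussian 1 (X.1 - t) * (FT d f₁ X.2.1 * FT d f₂ X.2.2)) *
        e2pi (⟪X.1, X.2.1 + X.2.2⟫ - ⟪X.1, ν⟫) *
          (gaussian (Real.pi ^ 2 + (1 + Real.pi ^ 2)) (X.2.1 - η₁)
          * gaussian (Real.pi ^ 2 + (1 + Real.pi ^ 2)) (X.2.2 - η₂) : ℝ)
      = c * c * ∫ X, ∫ s, Q (X, s) := by
    rw [← integral_const_mul]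
    congr 1
    ext X
    have h₁ := hc f₁ hf₁ hc₁ X.2.1 η₁
    have h₂ := hc f₂ hf₂ hc₂ X.2.2 η₂
    have h₃ : ∫ s, Q (X, s) = P X * e2pi (⟪X.1, X.2.1 + X.2.2⟫ - ⟪X.1, ν⟫) *
        ((∫ s, e2pi ⟪s, η₁ - X.2.1⟫ * STFT d (gauss d) f₁ s η₁) *
          ∫ s, e2pi ⟪s, η₂ - X.2.2⟫ * STFT d (gauss d) f₂ s η₂) := by
      rw [← integral_prod_mul, ← integral_const_mul, ← Measure.volume_eq_prod]
      congr 1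
      ext s
      simp only [Q, V]
      rw [e2pi_add, e2pi_add]
      ring
    rw [h₃, gaussian_add_mul (Real.pi ^ 2), gaussian_add_mul (Real.pi ^ 2)]
    simp only [P]
    push_cast
    linear_combination (σ X * gaussian 1 (X.1 - t) * e2pi (⟪X.1, X.2.1 + X.2.2⟫ - ⟪X.1, ν⟫) *
      gaussian (1 + Real.pi ^ 2) (X.2.1 - η₁) * gaussian (1 + Real.pi ^ 2) (X.2.2 - η₂)) *
      (FT d f₂ X.2.2 * gaussian (Real.pi ^ 2) (X.2.2 - η₂) * h₁ +
        (c * ∫ s, e2pi ⟪s, η₁ - X.2.1⟫ * STFT d (gauss d) f₁ s η₁) * h₂)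
  rw [heq, integral_integral_swap hQ, enorm_mul]
  refine mul_le_mul' le_rfl ((enorm_integral_le_lintegral_enorm _).trans
    (lintegral_mono fun s => le_of_eq ?_))
  rw [← enorm_mul, ← enorm_mul, ← integral_const_mul]
  congr 2
  ext X
  simp only [Q, V, P]
  ring

theorem exists_enorm_stft_biOp_le (d : ℕ) :
    ∃ C : ℝ≥0, ∀ σ : Ed d × Ed d × Ed d → ℂ, Measurable σ → (∃ M : ℝ, ∀ X, ‖σ X‖ ≤ M) →
      ∀ f₁ f₂ : SchwartzMap (Ed d) ℂ, ∀ t ν : Ed d,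
      ‖STFT d (gauss d) (biOp d σ f₁ f₂) t ν‖ₑ ≤ C * ∫⁻ η : Ed d × Ed d, ∫⁻ s : Ed d × Ed d,
        ‖STFT d (gauss d) f₁ s.1 η.1‖ₑ * ‖STFT d (gauss d) f₂ s.2 η.2‖ₑ *
        ∫⁻ p : Ed d × Ed d × Ed d, ENNReal.ofReal (chirpKernel p) *
          ‖symbSTFT d (gauss3 d) σ (t + (3⁻¹ : ℝ) • (p.1 + p.2.1)) (t - s.1 + p.1) (t - s.2 + p.2.1)
            η.1 η.2 (ν - η.1 - η.2 - p.2.2)‖ₑ := by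
  obtain ⟨C₁, h₁⟩ := exists_enorm_integral_le_lintegral_localized d
    (b := Real.pi ^ 2 + (1 + Real.pi ^ 2)) (by positivity)
  obtain ⟨C₂, h₂⟩ := exists_enorm_localized_integral_le d
  obtain ⟨C₃, h₃⟩ := exists_enorm_chirped_symbol_integral_le d
  refine ⟨C₁ * C₂ * C₃, fun σ hσ hb f₁ f₂ t ν => ?_⟩
  obtain ⟨M, hM⟩ := hb
  rw [stft_biOp_eq hσ hM (integrable_FT_schwartz f₁) (integrable_FT_schwartz f₂)]
  refine (h₁ _ (integrable_stft_biOp_integrand hσ hM (integrable_FT_schwartz f₁)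
    (integrable_FT_schwartz f₂) t ν)).trans ?_
  rw [ENNReal.coe_mul, ENNReal.coe_mul, mul_assoc, mul_assoc]
  refine mul_le_mul' le_rfl ?_
  rw [← mul_assoc, ← ENNReal.coe_mul, ← lintegral_const_mul' _ _ ENNReal.coe_ne_top]
  refine lintegral_mono fun η => ?_
  rw [ENNReal.coe_mul, mul_assoc]
  refine (h₂ σ hσ ⟨M, hM⟩ f₁ f₂ f₁.integrable f₁.continuous f₂.integrable f₂.continuous t ν
    η.1 η.2).trans (mul_le_mul' le_rfl ?_)
  rw [← lintegral_const_mul' _ _ ENNReal.coe_ne_top]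
  refine lintegral_mono fun s => ?_
  rw [mul_left_comm]
  exact mul_le_mul' le_rfl (h₃ σ hσ ⟨M, hM⟩ t ν η.1 η.2 s.1 s.2)

theorem measurable_ofReal_gaussian {d : ℕ} (b : ℝ) :
    Measurable fun x : Ed d => ENNReal.ofReal (gaussian b x) :=
  (continuous_gaussian b).measurable.ennreal_ofReal

theorem exists_eNorm_gaussian_smoothing_le (d : ℕ) {b : ℝ} (hb : 0 < b) {p r : ℝ≥0∞} (hp : 1 ≤ p)
    (hr : p ≤ r) :
    ∃ C : ℝ≥0, ∀ (a : Ed d → ℝ≥0∞), Measurable a → ∀ τ : Ed d,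
      eNorm volume r (fun t => ∫⁻ w, ENNReal.ofReal (gaussian b w) * a (t + w - τ))
        ≤ C * eNorm volume p a := by
  obtain ⟨C, hC⟩ := eNorm_convolution_le_of_le hp hr (measurable_ofReal_gaussian (d := d) b)
    fun s hs => eNorm_gaussian_lt_top hb hs
  refine ⟨C, fun a ha τ => le_of_eq_of_le ?_ (hC a ha)⟩
  have hm : Measurable fun x => ∫⁻ y : Ed d, a y * ENNReal.ofReal (gaussian b (x - y)) := by
    refine Measurable.lintegral_prod_right (f := fun x y : Ed d =>
      a y * ENNReal.ofReal (gaussian b (x - y))) ?_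
    exact (ha.comp measurable_snd).mul
      ((measurable_ofReal_gaussian b).comp (measurable_fst.sub measurable_snd))
  rw [← eNorm_comp_measurePreserving (measurePreserving_sub_right volume τ) r hm]
  congr 1
  ext t
  rw [← lintegral_sub_right_eq_self _ (t - τ)]
  refine lintegral_congr fun w => ?_
  rw [gaussian_sub_comm, mul_comm, show t + (w - (t - τ)) - τ = w by abel]

theorem exists_eNorm_gaussian_smoothing_mul_le (d : ℕ) {b : ℝ} (hb : 0 < b) {p₀ p₁ p₂ : ℝ≥0∞}
    (hp₀ : 1 ≤ p₀) (hp₁ : 1 ≤ p₁) (hp₂ : 1 ≤ p₂) (hP : p₀⁻¹ ≤ p₁⁻¹ + p₂⁻¹) :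
    ∃ C : ℝ≥0, ∀ (a₁ a₂ Θ : Ed d → ℝ≥0∞), Measurable a₁ → Measurable a₂ → Measurable Θ →
      ∀ τ₁ τ₂ : Ed d,
      eNorm volume p₀ (fun t => ∫⁻ w : Ed d × Ed d,
        (ENNReal.ofReal (gaussian b w.1) * ENNReal.ofReal (gaussian b w.2)) *
          (a₁ (t + w.1 - τ₁) * a₂ (t + w.2 - τ₂) * Θ (t + (3⁻¹ : ℝ) • (w.1 + w.2))))
        ≤ C * (essSup Θ volume * (eNorm volume p₁ a₁ * eNorm volume p₂ a₂)) := by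
  obtain ⟨r₁, r₂, hr₁, hr₂, hr⟩ := exists_exponents_add_inv_eq hP
  obtain ⟨C₁, h₁⟩ := exists_eNorm_gaussian_smoothing_le d hb hp₁ hr₁
  obtain ⟨C₂, h₂⟩ := exists_eNorm_gaussian_smoothing_le d hb hp₂ hr₂
  refine ⟨C₁ * C₂, fun a₁ a₂ Θ ha₁ ha₂ hΘ τ₁ τ₂ => ?_⟩
  let c (a : Ed d → ℝ≥0∞) (τ t : Ed d) : ℝ≥0∞ :=
    ∫⁻ w, ENNReal.ofReal (gaussian b w) * a (t + w - τ)
  have hm : ∀ (a : Ed d → ℝ≥0∞), Measurable a → ∀ τ, Measurable fun z : Ed d × Ed d =>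
      ENNReal.ofReal (gaussian b z.2) * a (z.1 + z.2 - τ) := fun a ha τ =>
    ((measurable_ofReal_gaussian b).comp measurable_snd).mul
      (ha.comp ((measurable_fst.add measurable_snd).sub_const τ))
  have hc : ∀ (a : Ed d → ℝ≥0∞), Measurable a → ∀ τ, Measurable (c a τ) := fun a ha τ =>
    (hm a ha τ).lintegral_prod_right'
  have hae : ∀ᵐ t : Ed d, ∀ᵐ w : Ed d × Ed d,
      Θ (t + (3⁻¹ : ℝ) • (w.1 + w.2)) ≤ essSup Θ volume := by
    have hmeas : Measurable fun z : Ed d × Ed d × Ed d =>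
        Θ (z.1 + (3⁻¹ : ℝ) • (z.2.1 + z.2.2)) :=
      hΘ.comp (Continuous.measurable (by fun_prop))
    refine (Measure.ae_ae_comm (p := fun (t : Ed d) (w : Ed d × Ed d) =>
      Θ (t + (3⁻¹ : ℝ) • (w.1 + w.2)) ≤ essSup Θ volume)
      (measurableSet_le hmeas measurable_const)).2
      (Filter.Eventually.of_forall fun w => ?_)
    exact (measurePreserving_add_right volume ((3⁻¹ : ℝ) • (w.1 + w.2))).quasiMeasurePreserving.ae
      (ENNReal.ae_le_essSup Θ)
  have hle : ∀ᵐ t : Ed d, ∫⁻ w : Ed d × Ed d,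
        (ENNReal.ofReal (gaussian b w.1) * ENNReal.ofReal (gaussian b w.2)) *
          (a₁ (t + w.1 - τ₁) * a₂ (t + w.2 - τ₂) * Θ (t + (3⁻¹ : ℝ) • (w.1 + w.2)))
      ≤ essSup Θ volume * (c a₁ τ₁ t * c a₂ τ₂ t) := by
    filter_upwards [hae] with t ht
    have hm₁ := (hm a₁ ha₁ τ₁).comp (measurable_prodMk_left (x := t))
    have hm₂ := (hm a₂ ha₂ τ₂).comp (measurable_prodMk_left (x := t))
    have hprod := lintegral_prod_mul (μ := (volume : Measure (Ed d)))
      (ν := (volume : Measure (Ed d))) hm₁.aemeasurable hm₂.aemeasurable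
    simp only [Function.comp_apply] at hprod
    have hmm : Measurable fun z : Ed d × Ed d => ENNReal.ofReal (gaussian b z.1) *
        a₁ (t + z.1 - τ₁) * (ENNReal.ofReal (gaussian b z.2) * a₂ (t + z.2 - τ₂)) :=
      (hm₁.comp measurable_fst).mul (hm₂.comp measurable_snd)
    rw [← hprod]
    refine le_of_le_of_eq (lintegral_mono_ae ?_) (lintegral_const_mul _ hmm)
    filter_upwards [ht] with w hw
    calc _ ≤ (ENNReal.ofReal (gaussian b w.1) * ENNReal.ofReal (gaussian b w.2)) *
          (a₁ (t + w.1 - τ₁) * a₂ (t + w.2 - τ₂) * essSup Θ volume) := by gcongr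
      _ = _ := by ring
  calc _ ≤ eNorm volume p₀ fun t => essSup Θ volume * (c a₁ τ₁ t * c a₂ τ₂ t) :=
        eNorm_mono_ae _ hle
    _ ≤ essSup Θ volume * eNorm volume p₀ fun t => c a₁ τ₁ t * c a₂ τ₂ t :=
        eNorm_const_mul_le hp₀ _ ((hc a₁ ha₁ τ₁).mul (hc a₂ ha₂ τ₂))
    _ ≤ essSup Θ volume * ((C₁ * eNorm volume p₁ a₁) * (C₂ * eNorm volume p₂ a₂)) := by
        refine mul_le_mul' le_rfl ((eNorm_mul_le hp₀ hr (hc a₁ ha₁ τ₁) (hc a₂ ha₂ τ₂)).trans ?_)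
        exact mul_le_mul' (h₁ a₁ ha₁ τ₁) (h₂ a₂ ha₂ τ₂)
    _ = _ := by
        rw [ENNReal.coe_mul]
        ring

theorem ofReal_chirpKernel_le {d : ℕ} (w : Ed d × Ed d) (u : Ed d) :
    ENNReal.ofReal (chirpKernel (w.1, w.2, u)) ≤
      ENNReal.ofReal (gaussian (Real.pi ^ 2 / 2) u) *
        (ENNReal.ofReal (gaussian 3⁻¹ w.1) * ENNReal.ofReal (gaussian 3⁻¹ w.2)) := by
  rw [← ENNReal.ofReal_mul (gaussian_pos _ _).le, ← ENNReal.ofReal_mul (gaussian_pos _ _).le]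
  refine ENNReal.ofReal_le_ofReal ((chirpKernel_le _).trans_eq ?_)
  ring

theorem lintegral_prod_prod_eq_lintegral_lintegral {d : ℕ} {G : Ed d × Ed d × Ed d → ℝ≥0∞}
    (hG : Measurable G) : ∫⁻ p, G p = ∫⁻ u : Ed d, ∫⁻ w : Ed d × Ed d, G (w.1, w.2, u) := by
  rw [← (volume_preserving_prodAssoc (α₁ := Ed d) (β₁ := Ed d) (γ₁ := Ed d)).lintegral_comp hG]
  exact lintegral_prod_symm _ (hG.comp MeasurableEquiv.prodAssoc.measurable).aemeasurable

set_option synthInstance.maxSize 1024 in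
set_option synthInstance.maxHeartbeats 400000 in
theorem lintegral_chirp_rearrange {d : ℕ} {a₁ a₂ : Ed d → ℝ≥0∞}
    {Θ : Ed d × Ed d × Ed d × Ed d → ℝ≥0∞} (ha₁ : Measurable a₁) (ha₂ : Measurable a₂)
    (hΘ : Measurable Θ) (t : Ed d) :
    ∫⁻ s : Ed d × Ed d, a₁ s.1 * a₂ s.2 * ∫⁻ p : Ed d × Ed d × Ed d,
        ENNReal.ofReal (chirpKernel p) *
          Θ (t + (3⁻¹ : ℝ) • (p.1 + p.2.1), t - s.1 + p.1, t - s.2 + p.2.1, p.2.2)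
      ≤ ∫⁻ z : (Ed d × Ed d) × Ed d, ENNReal.ofReal (gaussian (Real.pi ^ 2 / 2) z.2) *
        ∫⁻ w : Ed d × Ed d,
          (ENNReal.ofReal (gaussian 3⁻¹ w.1) * ENNReal.ofReal (gaussian 3⁻¹ w.2)) *
          (a₁ (t + w.1 - z.1.1) * a₂ (t + w.2 - z.1.2) *
            Θ (t + (3⁻¹ : ℝ) • (w.1 + w.2), z.1.1, z.1.2, z.2)) := by
  have hk : Measurable fun p : Ed d × Ed d × Ed d => ENNReal.ofReal (chirpKernel p) :=
    continuous_chirpKernel.measurable.ennreal_ofReal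
  have hk3 := measurable_ofReal_gaussian (d := d) 3⁻¹
  let G : (Ed d × Ed d × Ed d) × (Ed d × Ed d) → ℝ≥0∞ := fun z =>
    ENNReal.ofReal (chirpKernel z.1) * (a₁ (t + z.1.1 - z.2.1) * a₂ (t + z.1.2.1 - z.2.2) *
      Θ (t + (3⁻¹ : ℝ) • (z.1.1 + z.1.2.1), z.2.1, z.2.2, z.1.2.2))
  have hG : Measurable G := by
    refine (hk.comp measurable_fst).mul (((ha₁.comp ?_).mul (ha₂.comp ?_)).mul (hΘ.comp ?_)) <;>
    exact Continuous.measurable (by fun_prop)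
  have hin : Measurable fun z : ((Ed d × Ed d) × Ed d) × (Ed d × Ed d) =>
      (ENNReal.ofReal (gaussian 3⁻¹ z.2.1) * ENNReal.ofReal (gaussian 3⁻¹ z.2.2)) *
          (a₁ (t + z.2.1 - z.1.1.1) * a₂ (t + z.2.2 - z.1.1.2) *
            Θ (t + (3⁻¹ : ℝ) • (z.2.1 + z.2.2), z.1.1.1, z.1.1.2, z.1.2)) := by
    refine ((hk3.comp ?_).mul (hk3.comp ?_)).mul
      (((ha₁.comp ?_).mul (ha₂.comp ?_)).mul (hΘ.comp ?_)) <;>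
    exact Continuous.measurable (by fun_prop)
  have hsub : Measurable fun z : (Ed d × Ed d) × (Ed d × Ed d × Ed d) =>
      (z.2, (t + z.2.1 - z.1.1, t + z.2.2.1 - z.1.2)) := Continuous.measurable (by fun_prop)
  calc _ = ∫⁻ s : Ed d × Ed d, ∫⁻ p : Ed d × Ed d × Ed d,
        G (p, (t + p.1 - s.1, t + p.2.1 - s.2)) := by
        refine lintegral_congr fun s => ?_
        rw [← lintegral_const_mul]
        · refine lintegral_congr fun p => ?_
          simp only [G, sub_sub_cancel, sub_add_eq_add_sub]
          ring
        · refine hk.mul (hΘ.comp ?_)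
          exact Continuous.measurable (by fun_prop)
    _ = ∫⁻ p : Ed d × Ed d × Ed d, ∫⁻ s : Ed d × Ed d,
        G (p, (t + p.1 - s.1, t + p.2.1 - s.2)) :=
        lintegral_lintegral_swap (hG.comp hsub).aemeasurable
    _ = ∫⁻ p : Ed d × Ed d × Ed d, ∫⁻ τ : Ed d × Ed d, G (p, τ) := by
        refine lintegral_congr fun p => ?_
        exact ((Measure.measurePreserving_sub_left volume (t + p.1)).prod
          (Measure.measurePreserving_sub_left volume (t + p.2.1))).lintegral_comp
          (hG.comp measurable_prodMk_left)
    _ = ∫⁻ τ : Ed d × Ed d, ∫⁻ p : Ed d × Ed d × Ed d, G (p, τ) :=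
        lintegral_lintegral_swap hG.aemeasurable
    _ ≤ ∫⁻ τ : Ed d × Ed d, ∫⁻ u : Ed d, ENNReal.ofReal (gaussian (Real.pi ^ 2 / 2) u) *
        ∫⁻ w : Ed d × Ed d,
          (ENNReal.ofReal (gaussian 3⁻¹ w.1) * ENNReal.ofReal (gaussian 3⁻¹ w.2)) *
          (a₁ (t + w.1 - τ.1) * a₂ (t + w.2 - τ.2) *
            Θ (t + (3⁻¹ : ℝ) • (w.1 + w.2), τ.1, τ.2, u)) := by
        refine lintegral_mono fun τ => ?_
        rw [lintegral_prod_prod_eq_lintegral_lintegral (G := fun p => G (p, τ))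
          (hG.comp measurable_prodMk_right)]
        refine lintegral_mono fun u => ?_
        rw [← lintegral_const_mul' _ _ ENNReal.ofReal_ne_top]
        refine lintegral_mono fun w => ?_
        rw [← mul_assoc]
        exact mul_le_mul' (ofReal_chirpKernel_le w u) le_rfl
    _ = _ := (lintegral_prod _ (((measurable_ofReal_gaussian _).comp measurable_snd).mul
        hin.lintegral_prod_right').aemeasurable).symm

theorem exists_eNorm_chirp_integral_le (d : ℕ) {p₀ p₁ p₂ : ℝ≥0∞}
    (hp₀ : 1 ≤ p₀) (hp₁ : 1 ≤ p₁) (hp₂ : 1 ≤ p₂) (hP : p₀⁻¹ ≤ p₁⁻¹ + p₂⁻¹) :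
    ∃ C : ℝ≥0, ∀ (a₁ a₂ : Ed d → ℝ≥0∞) (Θ : Ed d × Ed d × Ed d × Ed d → ℝ≥0∞),
      Measurable a₁ → Measurable a₂ → Measurable Θ →
      eNorm volume p₀ (fun t => ∫⁻ s : Ed d × Ed d, a₁ s.1 * a₂ s.2 *
        ∫⁻ p : Ed d × Ed d × Ed d, ENNReal.ofReal (chirpKernel p) *
          Θ (t + (3⁻¹ : ℝ) • (p.1 + p.2.1), t - s.1 + p.1, t - s.2 + p.2.1, p.2.2))
      ≤ C * (eNorm volume p₁ a₁ * eNorm volume p₂ a₂) *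
        ∫⁻ u, ENNReal.ofReal (gaussian (Real.pi ^ 2 / 2) u) *
          ∫⁻ t₂, ∫⁻ t₁, essSup (fun x => Θ (x, t₁, t₂, u)) volume := by
  obtain ⟨C, hC⟩ := exists_eNorm_gaussian_smoothing_mul_le d (b := 3⁻¹) (by norm_num) hp₀ hp₁ hp₂ hP
  refine ⟨C, fun a₁ a₂ Θ ha₁ ha₂ hΘ => ?_⟩
  have hk3 := measurable_ofReal_gaussian (d := d) 3⁻¹
  have hg := measurable_ofReal_gaussian (d := d) (Real.pi ^ 2 / 2)
  have hin : Measurable fun z : (Ed d × ((Ed d × Ed d) × Ed d)) × (Ed d × Ed d) =>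
      (ENNReal.ofReal (gaussian 3⁻¹ z.2.1) * ENNReal.ofReal (gaussian 3⁻¹ z.2.2)) *
          (a₁ (z.1.1 + z.2.1 - z.1.2.1.1) * a₂ (z.1.1 + z.2.2 - z.1.2.1.2) *
            Θ (z.1.1 + (3⁻¹ : ℝ) • (z.2.1 + z.2.2), z.1.2.1.1, z.1.2.1.2, z.1.2.2)) := by
    refine ((hk3.comp ?_).mul (hk3.comp ?_)).mul
      (((ha₁.comp ?_).mul (ha₂.comp ?_)).mul (hΘ.comp ?_)) <;>
    exact Continuous.measurable (by fun_prop)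
  have hS : Measurable fun z : (Ed d × Ed d) × Ed d =>
      essSup (fun x => Θ (x, z.1.1, z.1.2, z.2)) volume := by
    refine measurable_essSup (F := fun (z : (Ed d × Ed d) × Ed d) x => Θ (x, z.1.1, z.1.2, z.2))
      (hΘ.comp ?_)
    exact Continuous.measurable (by fun_prop)
  have hgS : Measurable fun z : (Ed d × Ed d) × Ed d =>
      ENNReal.ofReal (gaussian (Real.pi ^ 2 / 2) z.2) *
        essSup (fun x => Θ (x, z.1.1, z.1.2, z.2)) volume := (hg.comp measurable_snd).mul hS
  have hR := hin.lintegral_prod_right' (ν := (volume : Measure (Ed d × Ed d)))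
  calc _ ≤ eNorm volume p₀ (fun t => ∫⁻ z : (Ed d × Ed d) × Ed d,
        ENNReal.ofReal (gaussian (Real.pi ^ 2 / 2) z.2) * ∫⁻ w : Ed d × Ed d,
          (ENNReal.ofReal (gaussian 3⁻¹ w.1) * ENNReal.ofReal (gaussian 3⁻¹ w.2)) *
          (a₁ (t + w.1 - z.1.1) * a₂ (t + w.2 - z.1.2) *
            Θ (t + (3⁻¹ : ℝ) • (w.1 + w.2), z.1.1, z.1.2, z.2))) :=
        eNorm_mono_ae _ (Filter.Eventually.of_forall fun t =>
          lintegral_chirp_rearrange ha₁ ha₂ hΘ t)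
    _ ≤ ∫⁻ z : (Ed d × Ed d) × Ed d, eNorm volume p₀ fun t =>
        ENNReal.ofReal (gaussian (Real.pi ^ 2 / 2) z.2) * ∫⁻ w : Ed d × Ed d,
          (ENNReal.ofReal (gaussian 3⁻¹ w.1) * ENNReal.ofReal (gaussian 3⁻¹ w.2)) *
          (a₁ (t + w.1 - z.1.1) * a₂ (t + w.2 - z.1.2) *
            Θ (t + (3⁻¹ : ℝ) • (w.1 + w.2), z.1.1, z.1.2, z.2)) :=
        eNorm_lintegral_le hp₀ ((hg.comp (measurable_snd.comp measurable_snd)).mul hR)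
    _ ≤ ∫⁻ z : (Ed d × Ed d) × Ed d, C * (eNorm volume p₁ a₁ * eNorm volume p₂ a₂) *
        (ENNReal.ofReal (gaussian (Real.pi ^ 2 / 2) z.2) *
          essSup (fun x => Θ (x, z.1.1, z.1.2, z.2)) volume) := by
        refine lintegral_mono fun z => ?_
        refine (eNorm_const_mul_le hp₀ _ (hR.comp measurable_prodMk_right)).trans ?_
        refine (mul_le_mul' le_rfl (hC a₁ a₂ (fun x => Θ (x, z.1.1, z.1.2, z.2)) ha₁ ha₂
          (hΘ.comp measurable_prodMk_right) z.1.1 z.1.2)).trans_eq ?_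
        ring
    _ = _ := by
        rw [lintegral_const_mul _ hgS, Measure.volume_eq_prod,
          lintegral_prod_symm _ hgS.aemeasurable]
        congr 1
        refine lintegral_congr fun u => ?_
        dsimp only
        rw [lintegral_const_mul' _ _ ENNReal.ofReal_ne_top, Measure.volume_eq_prod]
        exact congrArg _ (lintegral_prod_symm (fun τ : Ed d × Ed d =>
          essSup (fun x => Θ (x, τ.1, τ.2, u)) volume)
          (hS.comp measurable_prodMk_right).aemeasurable)

theorem exists_eNorm_convolution_gaussian_le (d : ℕ) {b : ℝ} (hb : 0 < b) {q₁ q₂ q₃ : ℝ≥0∞}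
    (hq₁ : 1 ≤ q₁) (hq₂ : 1 ≤ q₂) (hq₃ : 1 ≤ q₃) (hQ : 1 + q₃⁻¹ ≤ q₁⁻¹ + q₂⁻¹) :
    ∃ C : ℝ≥0, ∀ (h a₁ a₂ : Ed d → ℝ≥0∞), Measurable h → Measurable a₁ → Measurable a₂ →
      eNorm volume q₃ (fun ν => ∫⁻ ν', h ν' * ∫⁻ η₁, a₁ η₁ * ∫⁻ η₂, a₂ η₂ *
        ENNReal.ofReal (gaussian b (ν - ν' - η₁ - η₂)))
      ≤ C * (∫⁻ ν, h ν) * eNorm volume q₁ a₁ * eNorm volume q₂ a₂ := by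
  have hq₁' : q₁⁻¹ ≤ 1 := ENNReal.inv_le_one.2 hq₁
  have hq₁t : q₁⁻¹ ≠ ∞ := ne_top_of_le_ne_top ENNReal.one_ne_top hq₁'
  let r : ℝ≥0∞ := (1 + q₃⁻¹ - q₁⁻¹)⁻¹
  have hr : q₁⁻¹ + r⁻¹ = 1 + q₃⁻¹ := by
    rw [inv_inv, add_tsub_cancel_of_le (hq₁'.trans le_self_add)]
  have hqr : q₂ ≤ r := by
    rw [← ENNReal.inv_le_inv, inv_inv]
    exact tsub_le_iff_left.2 hQ
  obtain ⟨C, hC⟩ := eNorm_convolution_le_of_le hq₂ hqr (measurable_ofReal_gaussian (d := d) b)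
    fun s hs => eNorm_gaussian_lt_top hb hs
  refine ⟨C, fun h a₁ a₂ hh ha₁ ha₂ => ?_⟩
  let c : Ed d → ℝ≥0∞ := fun x => ∫⁻ η₂, a₂ η₂ * ENNReal.ofReal (gaussian b (x - η₂))
  have hconv : ∀ f g : Ed d → ℝ≥0∞, Measurable f → Measurable g →
      Measurable fun x => ∫⁻ y, f y * g (x - y) := fun f g hf hg =>
    Measurable.lintegral_prod_right (f := fun x y : Ed d => f y * g (x - y))
      ((hf.comp measurable_snd).mul (hg.comp (measurable_fst.sub measurable_snd)))
  have hc : Measurable c := hconv _ _ ha₂ (measurable_ofReal_gaussian b)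
  calc _ ≤ eNorm volume 1 h * eNorm volume q₃ fun x => ∫⁻ η₁, a₁ η₁ * c (x - η₁) :=
        eNorm_convolution_le le_rfl hq₃ hq₃ (by rw [inv_one]) hh (hconv _ _ ha₁ hc)
    _ ≤ (∫⁻ ν, h ν) * (eNorm volume q₁ a₁ * (C * eNorm volume q₂ a₂)) := by
        rw [eNorm_one]
        refine mul_le_mul' le_rfl
          ((eNorm_convolution_le hq₁ (hq₂.trans hqr) hq₃ hr ha₁ hc).trans ?_)
        exact mul_le_mul' le_rfl (hC a₂ ha₂)
    _ = _ := by ring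

theorem lintegral_prod_gaussian_le {d : ℕ} (b : ℝ) {a₁ a₂ : Ed d → ℝ≥0∞}
    {T : (Ed d × Ed d) × Ed d → ℝ≥0∞} (ha₁ : Measurable a₁) (ha₂ : Measurable a₂)
    (hT : Measurable T) (ν : Ed d) :
    ∫⁻ η : Ed d × Ed d, a₁ η.1 * a₂ η.2 *
        ∫⁻ u, ENNReal.ofReal (gaussian b u) * T (η, ν - η.1 - η.2 - u)
      ≤ ∫⁻ ν', essSup (fun η => T (η, ν')) volume * ∫⁻ η₁, a₁ η₁ * ∫⁻ η₂, a₂ η₂ *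
        ENNReal.ofReal (gaussian b (ν - ν' - η₁ - η₂)) := by
  have hg := measurable_ofReal_gaussian (d := d) b
  have hm : Measurable fun z : (Ed d × Ed d) × Ed d =>
      a₁ z.1.1 * (a₂ z.1.2 * ENNReal.ofReal (gaussian b (ν - z.2 - z.1.1 - z.1.2))) := by
    refine (ha₁.comp ?_).mul ((ha₂.comp ?_).mul (hg.comp ?_)) <;>
    exact Continuous.measurable (by fun_prop)
  calc _ = ∫⁻ η : Ed d × Ed d, ∫⁻ ν' : Ed d, T (η, ν') *
        (a₁ η.1 * (a₂ η.2 * ENNReal.ofReal (gaussian b (ν - ν' - η.1 - η.2)))) := by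
        refine lintegral_congr fun η => ?_
        rw [← lintegral_sub_left_eq_self (μ := volume) _ (ν - η.1 - η.2), ← lintegral_const_mul]
        · refine lintegral_congr fun ν' => ?_
          rw [sub_sub_cancel, show ν - ν' - η.1 - η.2 = ν - η.1 - η.2 - ν' by abel]
          ring
        · refine (hg.comp ?_).mul (hT.comp ?_) <;>
          exact Continuous.measurable (by fun_prop)
    _ = ∫⁻ ν' : Ed d, ∫⁻ η : Ed d × Ed d, T (η, ν') *
        (a₁ η.1 * (a₂ η.2 * ENNReal.ofReal (gaussian b (ν - ν' - η.1 - η.2)))) :=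
        lintegral_lintegral_swap (hT.mul hm).aemeasurable
    _ ≤ ∫⁻ ν' : Ed d, ∫⁻ η : Ed d × Ed d, essSup (fun η => T (η, ν')) volume *
        (a₁ η.1 * (a₂ η.2 * ENNReal.ofReal (gaussian b (ν - ν' - η.1 - η.2)))) := by
        refine lintegral_mono fun ν' => lintegral_mono_ae ?_
        filter_upwards [ENNReal.ae_le_essSup fun η => T (η, ν')] with η hη
        exact mul_le_mul' hη le_rfl
    _ = _ := by
        refine lintegral_congr fun ν' => ?_
        have hm' : Measurable fun η : Ed d × Ed d =>
            a₁ η.1 * (a₂ η.2 * ENNReal.ofReal (gaussian b (ν - ν' - η.1 - η.2))) :=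
          hm.comp measurable_prodMk_right
        rw [lintegral_const_mul _ hm', Measure.volume_eq_prod, lintegral_prod _ hm'.aemeasurable]
        congr 1
        refine lintegral_congr fun η₁ => ?_
        have hm₂ : Measurable fun η₂ : Ed d =>
            a₂ η₂ * ENNReal.ofReal (gaussian b (ν - ν' - η₁ - η₂)) :=
          ha₂.mul (hg.comp (measurable_const.sub measurable_id))
        exact lintegral_const_mul (a₁ η₁) hm₂

set_option synthInstance.maxSize 1024 in
set_option synthInstance.maxHeartbeats 400000 in
theorem measurable_lintegral_chirp {d : ℕ} {F₁ F₂ : Ed d × Ed d → ℝ≥0∞}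
    {Φ : Ed d × Ed d × Ed d × Ed d × Ed d × Ed d → ℝ≥0∞} (hF₁ : Measurable F₁)
    (hF₂ : Measurable F₂) (hΦ : Measurable Φ) (ν : Ed d) :
    Measurable fun z : Ed d × (Ed d × Ed d) =>
      ∫⁻ s : Ed d × Ed d, F₁ (s.1, z.2.1) * F₂ (s.2, z.2.2) *
        ∫⁻ p : Ed d × Ed d × Ed d, ENNReal.ofReal (chirpKernel p) *
          Φ (z.1 + (3⁻¹ : ℝ) • (p.1 + p.2.1), z.1 - s.1 + p.1, z.1 - s.2 + p.2.1, z.2.1, z.2.2,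
            ν - z.2.1 - z.2.2 - p.2.2) := by
  have hk : Measurable fun p : Ed d × Ed d × Ed d => ENNReal.ofReal (chirpKernel p) :=
    continuous_chirpKernel.measurable.ennreal_ofReal
  have h : Measurable fun y : ((Ed d × (Ed d × Ed d)) × (Ed d × Ed d)) × (Ed d × Ed d × Ed d) =>
      ENNReal.ofReal (chirpKernel y.2) * Φ (y.1.1.1 + (3⁻¹ : ℝ) • (y.2.1 + y.2.2.1),
        y.1.1.1 - y.1.2.1 + y.2.1, y.1.1.1 - y.1.2.2 + y.2.2.1, y.1.1.2.1, y.1.1.2.2,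
        ν - y.1.1.2.1 - y.1.1.2.2 - y.2.2.2) := by
    refine (hk.comp measurable_snd).mul (hΦ.comp ?_)
    exact Continuous.measurable (by fun_prop)
  have h' : Measurable fun y : (Ed d × (Ed d × Ed d)) × (Ed d × Ed d) =>
      F₁ (y.2.1, y.1.2.1) * F₂ (y.2.2, y.1.2.2) := by
    refine (hF₁.comp ?_).mul (hF₂.comp ?_) <;>
    exact Continuous.measurable (by fun_prop)
  exact (h'.mul h.lintegral_prod_right').lintegral_prod_right'

set_option synthInstance.maxSize 1024 in
set_option synthInstance.maxHeartbeats 400000 in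
theorem exists_eNorm_eNorm_lintegral_chirp_le (d : ℕ) {p₀ p₁ p₂ q₁ q₂ q₃ : ℝ≥0∞}
    (hp₀ : 1 ≤ p₀) (hp₁ : 1 ≤ p₁) (hp₂ : 1 ≤ p₂) (hq₁ : 1 ≤ q₁) (hq₂ : 1 ≤ q₂) (hq₃ : 1 ≤ q₃)
    (hP : p₀⁻¹ ≤ p₁⁻¹ + p₂⁻¹) (hQ : 1 + q₃⁻¹ ≤ q₁⁻¹ + q₂⁻¹) (C₀ : ℝ≥0) :
    ∃ C : ℝ≥0, ∀ (F₁ F₂ : Ed d × Ed d → ℝ≥0∞)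
      (Φ : Ed d × Ed d × Ed d × Ed d × Ed d × Ed d → ℝ≥0∞),
      Measurable F₁ → Measurable F₂ → Measurable Φ →
      eNorm volume q₃ (fun ν => eNorm volume p₀ fun t => C₀ * ∫⁻ η : Ed d × Ed d,
        ∫⁻ s : Ed d × Ed d, F₁ (s.1, η.1) * F₂ (s.2, η.2) *
        ∫⁻ p : Ed d × Ed d × Ed d, ENNReal.ofReal (chirpKernel p) *
          Φ (t + (3⁻¹ : ℝ) • (p.1 + p.2.1), t - s.1 + p.1, t - s.2 + p.2.1, η.1, η.2,
            ν - η.1 - η.2 - p.2.2))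
      ≤ C * (∫⁻ ν, essSup (fun ξ : Ed d × Ed d => ∫⁻ t₂, ∫⁻ t₁,
          essSup (fun x => Φ (x, t₁, t₂, ξ.1, ξ.2, ν)) volume) volume) *
        (eNorm volume q₁ fun η => eNorm volume p₁ fun t => F₁ (t, η)) *
        (eNorm volume q₂ fun η => eNorm volume p₂ fun t => F₂ (t, η)) := by
  obtain ⟨C₁, h₁⟩ := exists_eNorm_chirp_integral_le d hp₀ hp₁ hp₂ hP
  obtain ⟨C₂, h₂⟩ := exists_eNorm_convolution_gaussian_le d (b := Real.pi ^ 2 / 2) (by positivity)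
    hq₁ hq₂ hq₃ hQ
  refine ⟨C₂ * (C₀ * C₁), fun F₁ F₂ Φ hF₁ hF₂ hΦ => ?_⟩
  let a₁ : Ed d → ℝ≥0∞ := fun η => eNorm volume p₁ fun t => F₁ (t, η)
  let a₂ : Ed d → ℝ≥0∞ := fun η => eNorm volume p₂ fun t => F₂ (t, η)
  let T : (Ed d × Ed d) × Ed d → ℝ≥0∞ := fun z => ∫⁻ t₂, ∫⁻ t₁,
    essSup (fun x => Φ (x, t₁, t₂, z.1.1, z.1.2, z.2)) volume
  have ha₁ : Measurable a₁ :=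
    measurable_eNorm (F := fun η t => F₁ (t, η)) p₁ (hF₁.comp measurable_swap)
  have ha₂ : Measurable a₂ :=
    measurable_eNorm (F := fun η t => F₂ (t, η)) p₂ (hF₂.comp measurable_swap)
  have hT : Measurable T := by
    have h : Measurable fun y : (((Ed d × Ed d) × Ed d) × Ed d) × Ed d =>
        essSup (fun x => Φ (x, y.2, y.1.2, y.1.1.1.1, y.1.1.1.2, y.1.1.2)) volume := by
      refine measurable_essSup (F := fun (y : (((Ed d × Ed d) × Ed d) × Ed d) × Ed d) x =>
        Φ (x, y.2, y.1.2, y.1.1.1.1, y.1.1.1.2, y.1.1.2)) (hΦ.comp ?_)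
      exact Continuous.measurable (by fun_prop)
    exact h.lintegral_prod_right'.lintegral_prod_right'
  let h : Ed d → ℝ≥0∞ := fun ν => essSup (fun ξ => T (ξ, ν)) volume
  have hh : Measurable h :=
    measurable_essSup (F := fun ν ξ => T (ξ, ν)) (hT.comp measurable_swap)
  have key : ∀ ν : Ed d, (eNorm volume p₀ fun t => C₀ * ∫⁻ η : Ed d × Ed d,
        ∫⁻ s : Ed d × Ed d, F₁ (s.1, η.1) * F₂ (s.2, η.2) *
        ∫⁻ p : Ed d × Ed d × Ed d, ENNReal.ofReal (chirpKernel p) *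
          Φ (t + (3⁻¹ : ℝ) • (p.1 + p.2.1), t - s.1 + p.1, t - s.2 + p.2.1, η.1, η.2,
            ν - η.1 - η.2 - p.2.2))
      ≤ ∫⁻ ν', ((C₀ * C₁ : ℝ≥0) * h ν') * ∫⁻ η₁, a₁ η₁ * ∫⁻ η₂, a₂ η₂ *
        ENNReal.ofReal (gaussian (Real.pi ^ 2 / 2) (ν - ν' - η₁ - η₂)) := by
    intro ν
    have hm := measurable_lintegral_chirp hF₁ hF₂ hΦ ν
    simp_rw [mul_assoc ((C₀ * C₁ : ℝ≥0) : ℝ≥0∞)]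
    rw [lintegral_const_mul' _ _ ENNReal.coe_ne_top, ENNReal.coe_mul, mul_assoc]
    refine (eNorm_const_mul_le hp₀ _ hm.lintegral_prod_right').trans (mul_le_mul' le_rfl ?_)
    refine (eNorm_lintegral_le hp₀ hm).trans ?_
    refine le_trans ?_ (mul_le_mul' le_rfl
      (lintegral_prod_gaussian_le (Real.pi ^ 2 / 2) ha₁ ha₂ hT ν))
    rw [← lintegral_const_mul' _ _ ENNReal.coe_ne_top]
    refine lintegral_mono fun η => ?_
    rw [← mul_assoc]
    refine h₁ (fun t => F₁ (t, η.1)) (fun t => F₂ (t, η.2))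
      (fun y => Φ (y.1, y.2.1, y.2.2.1, η.1, η.2, ν - η.1 - η.2 - y.2.2.2))
      (hF₁.comp measurable_prodMk_right) (hF₂.comp measurable_prodMk_right) (hΦ.comp ?_)
    exact Continuous.measurable (by fun_prop)
  refine (eNorm_mono_ae _ (Filter.Eventually.of_forall key)).trans ?_
  refine (h₂ _ a₁ a₂ (hh.const_mul _) ha₁ ha₂).trans_eq ?_
  rw [lintegral_const_mul _ hh, ENNReal.coe_mul C₂, ← mul_assoc (C₂ : ℝ≥0∞)]

/-- boundedness of bilinear pseudodifferential operators with symbols in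
`𝓜^{(∞,1,1);(∞,∞,1)}` on products of modulation spaces. -/
theorem stmt0 (d : ℕ) (hd : 1 ≤ d) (p₀ p₁ p₂ q₁ q₂ q₃ : ℝ≥0∞)
    (hp₀ : 1 ≤ p₀) (hp₁ : 1 ≤ p₁) (hp₂ : 1 ≤ p₂)
    (hq₁ : 1 ≤ q₁) (hq₂ : 1 ≤ q₂) (hq₃ : 1 ≤ q₃)
    (hP : 1 / p₀ ≤ 1 / p₁ + 1 / p₂)
    (hQ : 1 + 1 / q₃ ≤ 1 / q₁ + 1 / q₂) :
    ∃ C : ℝ≥0, 0 < C ∧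
      ∀ σ : Ed d × Ed d × Ed d → ℂ, Measurable σ → (∃ M : ℝ, ∀ X, ‖σ X‖ ≤ M) →
        normInf11 d σ < ∞ →
        ∀ f₁ f₂ : SchwartzMap (Ed d) ℂ,
          modNorm d p₀ q₃ (biOp d σ (⇑f₁) (⇑f₂)) ≤
            (C : ℝ≥0∞) * normInf11 d σ * modNorm d p₁ q₁ (⇑f₁) * modNorm d p₂ q₂ (⇑f₂) := by
  simp only [one_div] at hP hQ
  obtain ⟨C₀, h₀⟩ := exists_enorm_stft_biOp_le d
  obtain ⟨C, hC⟩ :=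
    exists_eNorm_eNorm_lintegral_chirp_le d hp₀ hp₁ hp₂ hq₁ hq₂ hq₃ hP hQ C₀
  refine ⟨C + 1, by positivity, fun σ hσ hM _ f₁ f₂ => ?_⟩
  refine (eNorm_mono_ae _ (Filter.Eventually.of_forall fun ν =>
    eNorm_mono_ae _ (Filter.Eventually.of_forall fun t => h₀ σ hσ hM f₁ f₂ t ν))).trans ?_
  refine (hC (fun z => ‖STFT d (gauss d) f₁ z.1 z.2‖ₑ) (fun z => ‖STFT d (gauss d) f₂ z.1 z.2‖ₑ)
    (fun z => ‖symbSTFT d (gauss3 d) σ z.1 z.2.1 z.2.2.1 z.2.2.2.1 z.2.2.2.2.1 z.2.2.2.2.2‖ₑ)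
    (measurable_stft f₁.continuous.measurable).enorm
    (measurable_stft f₂.continuous.measurable).enorm (measurable_symbSTFT hσ).enorm).trans ?_
  have hCC : (C : ℝ≥0∞) ≤ ((C + 1 : ℝ≥0) : ℝ≥0∞) := ENNReal.coe_le_coe.2 le_self_add
  exact mul_le_mul' (mul_le_mul' (mul_le_mul' hCC le_rfl) le_rfl) le_rfl

end
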